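/- For every knot-like complex C, the numerical invariants satisfy a_i(C) = 0 for all sufficiently large i. -/

import Mathlib

/-!
Common setup: the ring `R = 𝔽₂[U,V]/(UV = 0)`, bigraded free finitely generated chain
complexes over `R` ("pre-complexes"), knot-like complexes, local maps and local
equivalence, standard and semistandard complexes, short maps, the `Z^!` order,
the invariants `a_i`, `φ_j`, `P`, shift maps, tensor products, duals, and direct sums.
-/

set_option synthInstance.maxHeartbeats 1000000
set_option maxHeartbeats 1000000

noncomputable section

/-- The polynomial ring `𝔽₂[U,V]`. -/
abbrev PolyUV : Type := MvPolynomial (Fin 2) (ZMod 2)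

/-- The ideal `(U·V)`. -/
def IUV : Ideal PolyUV := Ideal.span {(MvPolynomial.X 0 * MvPolynomial.X 1 : PolyUV)}

/-- The ring `R = 𝔽₂[U,V]/(UV = 0)`. -/
abbrev RUV : Type := PolyUV ⧸ IUV

instance : CommRing RUV := Ideal.Quotient.commRing IUV

/-- The image of `U` in `R`. -/
def Uv : RUV := Ideal.Quotient.mk IUV (MvPolynomial.X 0)

/-- The image of `V` in `R`. -/
def Vv : RUV := Ideal.Quotient.mk IUV (MvPolynomial.X 1)

/-- `r ∈ R` is homogeneous of bidegree `(p, q)` for the bigrading with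
`gr(U) = (-2, 0)`, `gr(V) = (0, -2)`, `gr(1) = (0, 0)` (coefficients in `𝔽₂`). -/
def IsHomog (r : RUV) (p q : ℤ) : Prop :=
  r = 0 ∨ (∃ a : ℕ, r = Uv ^ a ∧ p = -(2 * (a : ℤ)) ∧ q = 0) ∨
    (∃ b : ℕ, r = Vv ^ b ∧ p = 0 ∧ q = -(2 * (b : ℤ)))

/-- A finitely generated free bigraded module over `R` with a distinguished basis
indexed by `Fin n`, together with a bigrading `gr` on the basis and a matrix `dm`
recording a prospective differential: `dm i j` is the coefficient of the `j`-th basis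
vector in the differential of the `i`-th basis vector. -/
structure PreCx where
  n : ℕ
  gr : Fin n → ℤ × ℤ
  dm : Fin n → Fin n → RUV

/-- The underlying free `R`-module of a pre-complex. -/
abbrev Msub (C : PreCx) : Type := Fin C.n →₀ RUV

/-- The differential of a pre-complex, as an `R`-linear map. -/
def dmap (C : PreCx) : Msub C →ₗ[RUV] Msub C :=
  Finsupp.linearCombination RUV fun i => ∑ j, Finsupp.single j (C.dm i j)

/-- The submodule `U·C ⊆ C`; `C/U` is the quotient by this submodule. -/
def uSub (C : PreCx) : Submodule RUV (Msub C) :=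
  LinearMap.range (LinearMap.lsmul RUV (Msub C) Uv)

/-- The submodule `V·C ⊆ C`; `C/V` is the quotient by this submodule. -/
def vSub (C : PreCx) : Submodule RUV (Msub C) :=
  LinearMap.range (LinearMap.lsmul RUV (Msub C) Vv)

/-- Chains which die in the homology of `C/U`: the preimage in `C` of the boundaries of
the induced differential on `C/U`. -/
def bdryU (C : PreCx) : Submodule RUV (Msub C) := uSub C ⊔ LinearMap.range (dmap C)

/-- Chains which die in the homology of `C/V`. -/
def bdryV (C : PreCx) : Submodule RUV (Msub C) := vSub C ⊔ LinearMap.range (dmap C)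

/-- A chain `x ∈ C` is homogeneous of bidegree `(p, q)`. -/
def ChainHomog (C : PreCx) (x : Msub C) (p q : ℤ) : Prop :=
  ∀ j, IsHomog (x j) (p - (C.gr j).1) (q - (C.gr j).2)

/-- `x` is a `V`-tower class generator: its class in `H_*(C/U)` is a `V`-nontorsion cycle
whose image generates `H_*(C/U)/(V-torsion)` (equivalently, it is maximally `V`-graded
among `V`-nontorsion classes). -/
def IsVTowerGen (C : PreCx) (x : Msub C) : Prop :=
  dmap C x ∈ uSub C ∧ (∀ k : ℕ, Vv ^ k • x ∉ bdryU C) ∧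
    ∀ z : Msub C, dmap C z ∈ uSub C →
      ∃ (r : RUV) (k : ℕ), Vv ^ k • (z - r • x) ∈ bdryU C

/-- `x` is a `U`-tower class generator: its class in `H_*(C/V)` is a `U`-nontorsion cycle
whose image generates `H_*(C/V)/(U-torsion)`. -/
def IsUTowerGen (C : PreCx) (x : Msub C) : Prop :=
  dmap C x ∈ vSub C ∧ (∀ k : ℕ, Uv ^ k • x ∉ bdryV C) ∧
    ∀ z : Msub C, dmap C z ∈ vSub C →
      ∃ (r : RUV) (k : ℕ), Uv ^ k • (z - r • x) ∈ bdryV C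

/-- `C` is a chain complex over `R` whose differential has degree `(-1, -1)`. -/
def IsCplx (C : PreCx) : Prop :=
  (∀ x, dmap C (dmap C x) = 0) ∧
    ∀ i j, IsHomog (C.dm i j) ((C.gr i).1 - 1 - (C.gr j).1) ((C.gr i).2 - 1 - (C.gr j).2)

/-- A knot-like complex: a free, finitely generated, bigraded chain complex over `R`
whose differential has degree `(-1,-1)`, such that `H_*(C/U)/(V`-torsion`) ≅ 𝔽₂[V]` with
all `V`-nontorsion elements of `H_*(C/U)` in `U`-grading `0`, and
`H_*(C/V)/(U`-torsion`) ≅ 𝔽₂[U]` with all `U`-nontorsion elements of `H_*(C/V)` in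
`V`-grading `0`. -/
structure IsKnotLike (C : PreCx) : Prop where
  dsq : ∀ x, dmap C (dmap C x) = 0
  dhomog : ∀ i j, IsHomog (C.dm i j)
    ((C.gr i).1 - 1 - (C.gr j).1) ((C.gr i).2 - 1 - (C.gr j).2)
  vTowerExists : ∃ x, IsVTowerGen C x
  vTowerGr : ∀ x p q, ChainHomog C x p q → dmap C x ∈ uSub C →
    (∀ k : ℕ, Vv ^ k • x ∉ bdryU C) → p = 0
  uTowerExists : ∃ x, IsUTowerGen C x
  uTowerGr : ∀ x p q, ChainHomog C x p q → dmap C x ∈ vSub C →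
    (∀ k : ℕ, Uv ^ k • x ∉ bdryV C) → q = 0

/-- A module map `f : C₁ → C₂` is homogeneous of bidegree `(s, t)`. -/
def MapHomogShift (C₁ C₂ : PreCx) (f : Msub C₁ →ₗ[RUV] Msub C₂) (s t : ℤ) : Prop :=
  ∀ i j, IsHomog (f (Finsupp.single i 1) j)
    ((C₁.gr i).1 + s - (C₂.gr j).1) ((C₁.gr i).2 + t - (C₂.gr j).2)

/-- A local map `f : C₁ → C₂`: an absolutely `U`-graded, relatively `V`-graded,
`R`-equivariant chain map inducing an isomorphism on `H_*(·/U)/(V-torsion)`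
(equivalently, taking `V`-tower generators to `V`-tower generators). -/
structure IsLocalMap (C₁ C₂ : PreCx) (f : Msub C₁ →ₗ[RUV] Msub C₂) : Prop where
  chain : ∀ x, f (dmap C₁ x) = dmap C₂ (f x)
  graded : ∃ s : ℤ, MapHomogShift C₁ C₂ f 0 s
  towers : ∀ x, IsVTowerGen C₁ x → IsVTowerGen C₂ (f x)

/-- `C₁ ≤ C₂`: there exists a local map `C₁ → C₂`. -/
def LocalLE (C₁ C₂ : PreCx) : Prop := ∃ f, IsLocalMap C₁ C₂ f

/-- Local equivalence of complexes: local maps in both directions. -/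
def LocalEquiv (C₁ C₂ : PreCx) : Prop := LocalLE C₁ C₂ ∧ LocalLE C₂ C₁

/-- `C` is reduced: `∂ ≡ 0 mod (U, V)`. -/
def Reduced (C : PreCx) : Prop := ∀ i j, C.dm i j ∈ Ideal.span ({Uv, Vv} : Set RUV)

/-! ### Standard complexes -/

/-- The shift in bigrading from `x_k` to `x_{k+1}` in a standard complex, where the
parameter joining them is `b` (`k` is the 0-based index of the parameter, so the
parameter is a `U`-power arrow if `k` is even and a `V`-power arrow if `k` is odd). -/
def stepShift (k : ℕ) (b : ℤ) : ℤ × ℤ :=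
  if k % 2 = 0 then
    if b < 0 then (2 * (b.natAbs : ℤ) - 1, -1) else (1 - 2 * (b.natAbs : ℤ), 1)
  else
    if b < 0 then (-1, 2 * (b.natAbs : ℤ) - 1) else (1, 1 - 2 * (b.natAbs : ℤ))

/-- Bigrading of `x_i` relative to `x_0` in the standard complex with parameters `L`. -/
def grRel (L : List ℤ) (i : ℕ) : ℤ × ℤ :=
  ∑ k ∈ Finset.range i, stepShift k (L.getD k 0)

/-- The bigrading of the standard complex of parameters `L`, normalized so that
`gr_U(x_0) = 0` and `gr_V(x_n) = 0`. -/
def stdGr (L : List ℤ) (i : Fin (L.length + 1)) : ℤ × ℤ :=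
  ((grRel L (i : ℕ)).1, (grRel L (i : ℕ)).2 - (grRel L L.length).2)

/-- The differential matrix of the standard complex of parameters `L = (b_1, …, b_n)`:
for `i` odd (1-based), `∂_U x_{i-1} = U^{|b_i|} x_i` if `b_i < 0` and
`∂_U x_i = U^{b_i} x_{i-1}` if `b_i > 0`; for `i` even the same with `V` in place of `U`;
all other differentials vanish. -/
def stdDm (L : List ℤ) (i j : Fin (L.length + 1)) : RUV :=
  if (j : ℕ) = (i : ℕ) + 1 ∧ L.getD (i : ℕ) 0 < 0 then
    (if (i : ℕ) % 2 = 0 then Uv else Vv) ^ (L.getD (i : ℕ) 0).natAbs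
  else if (i : ℕ) = (j : ℕ) + 1 ∧ 0 < L.getD (j : ℕ) 0 then
    (if (j : ℕ) % 2 = 0 then Uv else Vv) ^ (L.getD (j : ℕ) 0).natAbs
  else 0

/-- The standard complex `C(b_1, …, b_n)` of a list of parameters `L = (b_1, …, b_n)`,
with generators `x_0, …, x_n`.  (For `L = []` this is the trivial complex `R`.) -/
def StdCx (L : List ℤ) : PreCx := ⟨L.length + 1, stdGr L, stdDm L⟩

/-- `L` is a valid parameter sequence for a standard complex: all entries are nonzero
and the length is even (possibly zero). -/
def IsStdSeq (L : List ℤ) : Prop := (∀ b ∈ L, b ≠ 0) ∧ Even L.length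

/-- The trivial standard complex `C(0) = R`. -/
def trivCx : PreCx := StdCx []

/-- The bigrading of the semistandard complex `C'(b_1, …, b_n)` (`n` odd), inherited from
the ambient standard complex `C(b_1, …, b_n, 1)`. -/
def semiGr (L : List ℤ) (i : Fin (L.length + 1)) : ℤ × ℤ :=
  ((grRel L (i : ℕ)).1, (grRel L (i : ℕ)).2 - (grRel L L.length).2 + 1)

/-- The semistandard complex `C'(b_1, …, b_n)` (`n` odd): the subcomplex of
`C(b_1, …, b_n, 1)` generated by `x_0, …, x_n`. -/
def SemiStdCx (L : List ℤ) : PreCx := ⟨L.length + 1, semiGr L, stdDm L⟩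

/-! ### Tensor products, duals, direct sums -/

/-- The tensor product (over `R`) of two pre-complexes, with basis `x_i ⊗ y_j` and
differential `∂(x ⊗ y) = ∂x ⊗ y + x ⊗ ∂y` (signs are irrelevant in characteristic 2). -/
def tensorCx (C₁ C₂ : PreCx) : PreCx where
  n := C₁.n * C₂.n
  gr := fun p => C₁.gr (finProdFinEquiv.symm p).1 + C₂.gr (finProdFinEquiv.symm p).2
  dm := fun p q =>
    (if (finProdFinEquiv.symm p).2 = (finProdFinEquiv.symm q).2 then
      C₁.dm (finProdFinEquiv.symm p).1 (finProdFinEquiv.symm q).1 else 0) +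
    (if (finProdFinEquiv.symm p).1 = (finProdFinEquiv.symm q).1 then
      C₂.dm (finProdFinEquiv.symm p).2 (finProdFinEquiv.symm q).2 else 0)

/-- The dual complex `C^∨ = Hom_R(C, R)`, described on the dual basis: the gradings are
negated and the differential matrix is transposed. -/
def dualCx (C : PreCx) : PreCx := ⟨C.n, fun i => -C.gr i, fun i j => C.dm j i⟩

/-- The direct sum of two pre-complexes. -/
def sumCx (C₁ C₂ : PreCx) : PreCx where
  n := C₁.n + C₂.n
  gr := fun p => Sum.elim C₁.gr C₂.gr (finSumFinEquiv.symm p)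
  dm := fun p q =>
    match finSumFinEquiv.symm p, finSumFinEquiv.symm q with
    | Sum.inl i, Sum.inl k => C₁.dm i k
    | Sum.inr j, Sum.inr l => C₂.dm j l
    | _, _ => 0

/-- A homotopy equivalence of bigraded chain complexes over `R`: chain maps `f, g`
preserving the bigrading, with `g ∘ f ≃ id` and `f ∘ g ≃ id` via `R`-equivariant
homotopies of bidegree `(1, 1)`. -/
def HomotopyEquivCx (C₁ C₂ : PreCx) : Prop :=
  ∃ (f : Msub C₁ →ₗ[RUV] Msub C₂) (g : Msub C₂ →ₗ[RUV] Msub C₁)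
    (H : Msub C₁ →ₗ[RUV] Msub C₁) (K : Msub C₂ →ₗ[RUV] Msub C₂),
    (∀ x, f (dmap C₁ x) = dmap C₂ (f x)) ∧
    (∀ y, g (dmap C₂ y) = dmap C₁ (g y)) ∧
    MapHomogShift C₁ C₂ f 0 0 ∧ MapHomogShift C₂ C₁ g 0 0 ∧
    MapHomogShift C₁ C₁ H 1 1 ∧ MapHomogShift C₂ C₂ K 1 1 ∧
    (∀ x, g (f x) - x = dmap C₁ (H x) + H (dmap C₁ x)) ∧
    (∀ y, f (g y) - y = dmap C₂ (K y) + K (dmap C₂ y))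

/-- An isomorphism of bigraded chain complexes over `R`. -/
def IsBigradedChainIso (C₁ C₂ : PreCx) (f : Msub C₁ →ₗ[RUV] Msub C₂) : Prop :=
  Function.Bijective f ∧ (∀ x, f (dmap C₁ x) = dmap C₂ (f x)) ∧ MapHomogShift C₁ C₂ f 0 0

/-! ### Short maps -/

/-- A short map `f : C(b_1, …, b_n) ⇝ C`: an absolutely `U`-graded, relatively
`V`-graded `R`-module map which is a chain map at `x_1, …, x_{n-1}` and commutes with
the `V`-part of the differential at `x_n` (for reduced `C`, the failure
`∂ f(x_n) - f(∂_V x_n)` is exactly `∂_U f(x_n) ∈ U·C`). -/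
def IsShortMap (L : List ℤ) (C : PreCx) (f : Msub (StdCx L) →ₗ[RUV] Msub C) : Prop :=
  (∃ s : ℤ, MapHomogShift (StdCx L) C f 0 s) ∧
  (∀ i : Fin (L.length + 1), 1 ≤ (i : ℕ) → (i : ℕ) + 1 ≤ L.length →
    f (dmap (StdCx L) (Finsupp.single i 1)) = dmap C (f (Finsupp.single i 1))) ∧
  dmap C (f (Finsupp.single (Fin.last L.length) 1)) -
    f (dmap (StdCx L) (Finsupp.single (Fin.last L.length) 1)) ∈ uSub C

/-- A short local map: a short map sending the `V`-tower generator `x_0` to a `V`-tower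
generator (hence inducing an isomorphism on `H_*(·/U)/(V-torsion)`). -/
def IsShortLocalMap (L : List ℤ) (C : PreCx) (f : Msub (StdCx L) →ₗ[RUV] Msub C) : Prop :=
  IsShortMap L C f ∧ IsVTowerGen C (f (Finsupp.single (0 : Fin (L.length + 1)) 1))

/-- A local map from the semistandard complex `C'(b_1, …, b_n)` to a knot-like complex:
a grading-preserving `R`-equivariant chain map under which the class of `x_0`
generates `H_*(C/U)/(V-torsion)`. -/
def IsSemiLocalMap (L : List ℤ) (C : PreCx) (f : Msub (SemiStdCx L) →ₗ[RUV] Msub C) : Prop :=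
  (∀ x, f (dmap (SemiStdCx L) x) = dmap C (f x)) ∧
  MapHomogShift (SemiStdCx L) C f 0 0 ∧
  IsVTowerGen C (f (Finsupp.single (0 : Fin (L.length + 1)) 1))

/-! ### The order `Z^!` and the numerical invariants -/

/-- The embedding of `Z^!` into `ℚ` realizing the order
`-1 <^! -2 <^! ⋯ <^! 0 <^! ⋯ <^! 2 <^! 1`: send `0 ↦ 0` and `a ↦ 1/a` otherwise. -/
def qval (a : ℤ) : ℚ := if a = 0 then 0 else 1 / (a : ℚ)

/-- The order `≤^!` on `Z^!`. -/
def bangLE (a b : ℤ) : Prop := qval a ≤ qval b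

/-- Pad a finite sequence with trailing zeros. -/
def seqPad (L : List ℤ) (i : ℕ) : ℤ := L.getD i 0

/-- The lexicographic order on finite integer sequences induced by `≤^!`, padding the
shorter sequence with trailing zeros. -/
def bangLexLE (L₁ L₂ : List ℤ) : Prop :=
  (∀ i, seqPad L₁ i = seqPad L₂ i) ∨
    ∃ k, (∀ i < k, seqPad L₁ i = seqPad L₂ i) ∧ qval (seqPad L₁ k) < qval (seqPad L₂ k)

/-- `m` is an upper bound for `S ⊆ Z^!` with respect to `≤^!`. -/
def IsBangUB (S : Set ℤ) (m : ℤ) : Prop := ∀ b ∈ S, qval b ≤ qval m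

/-- `m = sup^! S`, the least upper bound of `S ⊆ Z^!` with respect to `≤^!`. -/
def IsBangLUB (S : Set ℤ) (m : ℤ) : Prop :=
  IsBangUB S m ∧ ∀ m' : ℤ, IsBangUB S m' → qval m ≤ qval m'

/-- Candidate set for the next invariant: given the already-constructed prefix `P`,
those nonzero `b` such that some standard complex `C(P, b, rest) ≤ C`. -/
def candSet (C : PreCx) (P : List ℤ) : Set ℤ :=
  {b | b ≠ 0 ∧ ∃ rest : List ℤ, IsStdSeq (P ++ b :: rest) ∧ LocalLE (StdCx (P ++ b :: rest)) C}

/-- `a` is the sequence of numerical invariants `a_i(C)` (indexed from `0`):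
once a term vanishes all later terms vanish, and otherwise each term is
`sup^!` of the corresponding candidate set. -/
def InvSeq (C : PreCx) (a : ℕ → ℤ) : Prop :=
  ∀ k : ℕ,
    ((∃ i < k, a i = 0) → a k = 0) ∧
    ((∀ i < k, a i ≠ 0) → IsBangLUB (candSet C ((List.range k).map a)) (a k))

/-- The first `n` terms of `a`, with the (all-zero) tail deleted. -/
def truncSeq (a : ℕ → ℤ) (n : ℕ) : List ℤ :=
  ((List.range n).map a).takeWhile (fun b => b != 0)

/-! ### The homomorphisms `φ_j`, `P` and the shifts `sh_m` -/

/-- `φ_j` of a standard complex `C(a_1, …, a_n)`: the signed count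
`#{i odd : a_i = j} − #{i odd : a_i = −j}` (with 1-based odd `i`). -/
def phi (j : ℕ) (L : List ℤ) : ℤ :=
  ∑ i ∈ Finset.range L.length,
    if i % 2 = 0 then
      (if L.getD i 0 = (j : ℤ) then 1 else 0) - (if L.getD i 0 = -(j : ℤ) then 1 else 0)
    else 0

/-- The shift `sh_m` on parameter sequences: entries of absolute value `≥ m` are pushed
one further from zero; entries of absolute value `< m` are fixed. -/
def shSeq (m : ℕ) (L : List ℤ) : List ℤ :=
  L.map fun a => if (m : ℤ) ≤ a then a + 1 else if a ≤ -(m : ℤ) then a - 1 else a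

/-- `P(C) = -2 ∑_{j>0} j φ_j(C) + ∑_i sgn a_i`, computed from the parameter sequence of
the standard representative (the sum over `j` is finite since `φ_j` vanishes for
`j` larger than any `|a_i|`). -/
def Pval (L : List ℤ) : ℤ :=
  -2 * (∑ j ∈ Finset.range ((L.map Int.natAbs).sum + 1), (j : ℤ) * phi j L) +
    (L.map Int.sign).sum

end

theorem mk_surj (r : RUV) : ∃ p : PolyUV, Ideal.Quotient.mk IUV p = r :=
  Ideal.Quotient.mk_surjective r

theorem Uv_mul_Vv : Uv * Vv = 0 := by
  rw [Uv, Vv, ← map_mul]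
  exact Ideal.Quotient.eq_zero_iff_mem.2 (Ideal.mem_span_singleton_self _)

theorem RUV_add_self (r : RUV) : r + r = 0 := by
  have h2 : (2 : RUV) = 0 := by
    have := map_ofNat ((Ideal.Quotient.mk IUV).comp (MvPolynomial.C : ZMod 2 →+* PolyUV)) 2
    rw [← this]
    exact map_zero _
  rw [← two_mul, h2, zero_mul]

/-- Induction on elements of `R`, generated additively from `1` by multiplication by `U`, `V`. -/
theorem RUV_induction {P : RUV → Prop} (zero : P 0) (one : P 1)
    (add : ∀ r s, P r → P s → P (r + s)) (mulU : ∀ r, P r → P (Uv * r))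
    (mulV : ∀ r, P r → P (Vv * r)) (r : RUV) : P r := by
  obtain ⟨p, rfl⟩ := mk_surj r
  induction p using MvPolynomial.induction_on with
  | C a =>
    obtain rfl | rfl : a = 0 ∨ a = 1 := by revert a; decide
    · simpa using zero
    · simpa using one
  | add p q hp hq => simpa using add _ _ hp hq
  | mul_X p n hp =>
    rw [map_mul, mul_comm]
    fin_cases n
    · exact mulU _ hp
    · exact mulV _ hp

/-- The augmentation `R → 𝔽₂`. -/
noncomputable def augm : RUV →+* ZMod 2 :=
  Ideal.Quotient.lift IUV (MvPolynomial.constantCoeff : PolyUV →+* ZMod 2) (by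
    intro a ha
    obtain ⟨c, rfl⟩ := Ideal.mem_span_singleton'.1 ha
    simp)

@[simp] theorem augm_Uv : augm Uv = 0 := by
  simp [augm, Uv]

@[simp] theorem augm_Vv : augm Vv = 0 := by
  simp [augm, Vv]

theorem exists_eq_of_augm (r : RUV) :
    ∃ s t : RUV, (augm r = 0 → r = Uv * s + Vv * t) ∧ (augm r = 1 → r = 1 + Uv * s + Vv * t) := by
  have key : ∀ r : RUV, ∃ s t : RUV, r = Uv * s + Vv * t ∨ r = 1 + Uv * s + Vv * t := by
    intro r
    induction r using RUV_induction with
    | zero => exact ⟨0, 0, by simp⟩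
    | one => exact ⟨0, 0, by simp⟩
    | add r₁ r₂ h₁ h₂ =>
      obtain ⟨s₁, t₁, h₁⟩ := h₁
      obtain ⟨s₂, t₂, h₂⟩ := h₂
      refine ⟨s₁ + s₂, t₁ + t₂, ?_⟩
      rcases h₁ with rfl | rfl <;> rcases h₂ with rfl | rfl
      · left; ring
      · right; ring
      · right; ring
      · left
        linear_combination RUV_add_self 1
    | mulU r h => exact ⟨r, 0, by simp⟩
    | mulV r h => exact ⟨0, r, by simp⟩
  obtain ⟨s, t, rfl | rfl⟩ := key r <;> refine ⟨s, t, ?_⟩ <;> simp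

theorem X_mul_mem_cancel {i j : Fin 2} (hij : i ≠ j) {p q : PolyUV}
    (h : MvPolynomial.X i * p - MvPolynomial.X j * q ∈ IUV) :
    (MvPolynomial.X j : PolyUV) ∣ p := by
  have hj : (MvPolynomial.X j : PolyUV) ∣ MvPolynomial.X 0 * MvPolynomial.X 1 := by
    fin_cases j
    · exact dvd_mul_right _ _
    · exact dvd_mul_left _ _
  have h1 : (MvPolynomial.X j : PolyUV) ∣ MvPolynomial.X i * p :=
    (dvd_sub_left (dvd_mul_right _ q)).1 (hj.trans (Ideal.mem_span_singleton.1 h))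
  rcases (MvPolynomial.X_prime (R := ZMod 2) (i := j)).dvd_or_dvd h1 with h2 | h2
  · exact absurd (MvPolynomial.X_dvd_X.1 h2).symm hij
  · exact h2

theorem Vv_dvd_of_Uv_mul_eq {r s : RUV} (h : Uv * r = Vv * s) : Vv ∣ r := by
  obtain ⟨p, rfl⟩ := mk_surj r
  obtain ⟨q, rfl⟩ := mk_surj s
  rw [Uv, Vv, ← map_mul, ← map_mul, Ideal.Quotient.mk_eq_mk_iff_sub_mem] at h
  exact map_dvd _ (X_mul_mem_cancel (by decide) h)

theorem Uv_dvd_of_Vv_mul_eq {r s : RUV} (h : Vv * r = Uv * s) : Uv ∣ r := by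
  obtain ⟨p, rfl⟩ := mk_surj r
  obtain ⟨q, rfl⟩ := mk_surj s
  rw [Uv, Vv, ← map_mul, ← map_mul, Ideal.Quotient.mk_eq_mk_iff_sub_mem] at h
  exact map_dvd _ (X_mul_mem_cancel (by decide) h)

/-- The variable labelling the `i`-th arrow of a standard complex. -/
noncomputable def tv (i : ℕ) : RUV := if i % 2 = 0 then Uv else Vv

theorem tv_zero : tv 0 = Uv := rfl

theorem tv_add_two (i : ℕ) : tv (i + 2) = tv i := by simp [tv]

theorem tv_add_even (i : ℕ) {p : ℕ} (hp : Even p) : tv (i + p) = tv i := by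
  obtain ⟨c, rfl⟩ := hp
  have : (i + (c + c)) % 2 = i % 2 := by omega
  simp [tv, this]

theorem tv_eq_or (i : ℕ) : (tv i = Uv ∧ tv (i + 1) = Vv) ∨ (tv i = Vv ∧ tv (i + 1) = Uv) := by
  rcases Nat.mod_two_eq_zero_or_one i with h | h
  · left; simp [tv, h]; omega
  · right; simp [tv, h]; omega

theorem tv_mul_succ (i : ℕ) : tv i * tv (i + 1) = 0 := by
  rcases tv_eq_or i with ⟨h, h'⟩ | ⟨h, h'⟩ <;> rw [h, h']
  · exact Uv_mul_Vv
  · rw [mul_comm, Uv_mul_Vv]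

theorem tv_dvd_of_mul_eq (i : ℕ) {r s : RUV} (h : tv i * r = tv (i + 1) * s) :
    tv (i + 1) ∣ r := by
  rcases tv_eq_or i with ⟨h₁, h₂⟩ | ⟨h₁, h₂⟩ <;> rw [h₁, h₂] at h <;> rw [h₂]
  · exact Vv_dvd_of_Uv_mul_eq h
  · exact Uv_dvd_of_Vv_mul_eq h

theorem Vv_pow_not_dvd (k : ℕ) : ¬ Uv ∣ Vv ^ k := by
  induction k with
  | zero =>
    rintro ⟨c, hc⟩
    simpa using congrArg augm hc
  | succ k ih =>
    rintro ⟨c, hc⟩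
    exact ih (Uv_dvd_of_Vv_mul_eq (by rw [← pow_succ', hc]))

/-! ### Homogeneous components of `R` -/

/-- The ring map recording the bigrading of `R` in a Laurent variable. -/
noncomputable def gradeHom : RUV →+* AddMonoidAlgebra RUV (ℤ × ℤ) :=
  Ideal.Quotient.lift IUV
    (MvPolynomial.eval₂Hom ((algebraMap RUV (AddMonoidAlgebra RUV (ℤ × ℤ))).comp
      (algebraMap (ZMod 2) RUV))
      (fun i => AddMonoidAlgebra.single (if i = 0 then (-2, 0) else (0, -2))
        (if i = 0 then Uv else Vv))) (by
    intro a ha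
    obtain ⟨c, rfl⟩ := Ideal.mem_span_singleton'.1 ha
    simp [AddMonoidAlgebra.single_mul_single, Uv_mul_Vv])

theorem gradeHom_Uv : gradeHom Uv = AddMonoidAlgebra.single (-2, 0) Uv := by
  simp [gradeHom, Uv]

theorem gradeHom_Vv : gradeHom Vv = AddMonoidAlgebra.single (0, -2) Vv := by
  simp [gradeHom, Vv]

/-- The homogeneous component of bidegree `d` of an element of `R`. -/
noncomputable def gcomp (d : ℤ × ℤ) (r : RUV) : RUV := (gradeHom r).coeff d

theorem gcomp_add (d : ℤ × ℤ) (r s : RUV) : gcomp d (r + s) = gcomp d r + gcomp d s := by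
  simp [gcomp]

@[simp] theorem gcomp_zero (d : ℤ × ℤ) : gcomp d 0 = 0 := by
  simp [gcomp]

theorem gcomp_one (d : ℤ × ℤ) : gcomp d 1 = if d = 0 then 1 else 0 := by
  simp [gcomp, AddMonoidAlgebra.one_def, Finsupp.single_apply, eq_comm]

theorem gcomp_Uv_mul (d : ℤ × ℤ) (r : RUV) : gcomp d (Uv * r) = Uv * gcomp ((2, 0) + d) r := by
  simp [gcomp, gradeHom_Uv]

theorem gcomp_Vv_mul (d : ℤ × ℤ) (r : RUV) : gcomp d (Vv * r) = Vv * gcomp ((0, 2) + d) r := by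
  simp [gcomp, gradeHom_Vv]

theorem isHomog_zero (p q : ℤ) : IsHomog 0 p q := Or.inl rfl

theorem IsHomog.Uv_mul {r : RUV} {p q : ℤ} (h : IsHomog r p q) : IsHomog (Uv * r) (p - 2) q := by
  rcases h with rfl | ⟨a, rfl, rfl, rfl⟩ | ⟨b, rfl, rfl, rfl⟩
  · left; simp
  · right; left
    exact ⟨a + 1, by rw [pow_succ'], by push_cast; ring, rfl⟩
  · rcases b with _ | b
    · right; left
      exact ⟨1, by simp, by simp, by simp⟩
    · left
      rw [pow_succ', ← mul_assoc, Uv_mul_Vv, zero_mul]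

theorem IsHomog.Vv_mul {r : RUV} {p q : ℤ} (h : IsHomog r p q) : IsHomog (Vv * r) p (q - 2) := by
  rcases h with rfl | ⟨a, rfl, rfl, rfl⟩ | ⟨b, rfl, rfl, rfl⟩
  · left; simp
  · rcases a with _ | a
    · right; right
      exact ⟨1, by simp, by simp, by simp⟩
    · left
      rw [pow_succ', ← mul_assoc, mul_comm Vv, Uv_mul_Vv, zero_mul]
  · right; right
    exact ⟨b + 1, by rw [pow_succ'], rfl, by push_cast; ring⟩

/-- Nonzero homogeneous elements of `R` are determined by their bidegree. -/
theorem IsHomog.eq_of_ne_zero {r s : RUV} {p q : ℤ} (hr : IsHomog r p q) (hs : IsHomog s p q)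
    (hr0 : r ≠ 0) (hs0 : s ≠ 0) : r = s := by
  rcases hr with hr | ⟨a, rfl, ha, ha'⟩ | ⟨a, rfl, ha, ha'⟩
  · exact absurd hr hr0
  · rcases hs with hs | ⟨b, rfl, hb, hb'⟩ | ⟨b, rfl, hb, hb'⟩
    · exact absurd hs hs0
    · rw [show a = b by omega]
    · rw [show a = 0 by omega, show b = 0 by omega, pow_zero, pow_zero]
  · rcases hs with hs | ⟨b, rfl, hb, hb'⟩ | ⟨b, rfl, hb, hb'⟩
    · exact absurd hs hs0
    · rw [show a = 0 by omega, show b = 0 by omega, pow_zero, pow_zero]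
    · rw [show a = b by omega]

theorem IsHomog.add {r s : RUV} {p q : ℤ} (hr : IsHomog r p q) (hs : IsHomog s p q) :
    IsHomog (r + s) p q := by
  by_cases hr0 : r = 0
  · simpa [hr0] using hs
  by_cases hs0 : s = 0
  · simpa [hs0] using hr
  rw [hr.eq_of_ne_zero hs hr0 hs0, RUV_add_self]
  exact isHomog_zero p q

theorem isHomog_gcomp (d : ℤ × ℤ) (r : RUV) : IsHomog (gcomp d r) d.1 d.2 := by
  induction r using RUV_induction generalizing d with
  | zero => simpa using isHomog_zero _ _
  | one =>
    rw [gcomp_one]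
    split_ifs with h
    · subst h
      exact Or.inr (Or.inl ⟨0, by simp, by simp, by simp⟩)
    · exact isHomog_zero _ _
  | add r s hr hs => rw [gcomp_add]; exact (hr d).add (hs d)
  | mulU r hr =>
    rw [gcomp_Uv_mul]
    convert (hr ((2, 0) + d)).Uv_mul using 1 <;> simp
  | mulV r hr =>
    rw [gcomp_Vv_mul]
    convert (hr ((0, 2) + d)).Vv_mul using 1 <;> simp

theorem gcomp_gcomp (d e : ℤ × ℤ) (r : RUV) :
    gcomp d (gcomp e r) = if d = e then gcomp e r else 0 := by
  induction r using RUV_induction generalizing d e with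
  | zero => simp
  | one =>
    rw [gcomp_one]
    split_ifs with h1 h2 h2
    · subst h1; subst h2; simp [gcomp_one]
    · subst h1; simp [gcomp_one, h2]
    · simp
    · simp
  | add r s hr hs =>
    rw [gcomp_add, gcomp_add, hr, hs]
    split_ifs <;> simp
  | mulU r hr =>
    rw [gcomp_Uv_mul, gcomp_Uv_mul, hr]
    simp
  | mulV r hr =>
    rw [gcomp_Vv_mul, gcomp_Vv_mul, hr]
    simp

theorem gcomp_mul_of_isHomog {s : RUV} {e : ℤ × ℤ} (hs : IsHomog s e.1 e.2) (d : ℤ × ℤ)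
    (r : RUV) : gcomp (d + e) (r * s) = gcomp d r * s := by
  have hU : ∀ (a : ℕ) (d : ℤ × ℤ),
      gcomp (d + (-(2 * (a : ℤ)), 0)) (r * Uv ^ a) = gcomp d r * Uv ^ a := by
    intro a
    induction a with
    | zero => simp
    | succ a ih =>
      intro d
      rw [pow_succ', show r * (Uv * Uv ^ a) = Uv * (r * Uv ^ a) by ring, gcomp_Uv_mul,
        show gcomp d r * (Uv * Uv ^ a) = Uv * (gcomp d r * Uv ^ a) by ring, ← ih,
        show ((2, 0) : ℤ × ℤ) + (d + (-(2 * ((a + 1 : ℕ) : ℤ)), 0)) = d + (-(2 * (a : ℤ)), 0) by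
          ext <;> push_cast <;> simp; ring]
  have hV : ∀ (a : ℕ) (d : ℤ × ℤ),
      gcomp (d + (0, -(2 * (a : ℤ)))) (r * Vv ^ a) = gcomp d r * Vv ^ a := by
    intro a
    induction a with
    | zero => simp
    | succ a ih =>
      intro d
      rw [pow_succ', show r * (Vv * Vv ^ a) = Vv * (r * Vv ^ a) by ring, gcomp_Vv_mul,
        show gcomp d r * (Vv * Vv ^ a) = Vv * (gcomp d r * Vv ^ a) by ring, ← ih,
        show ((0, 2) : ℤ × ℤ) + (d + (0, -(2 * ((a + 1 : ℕ) : ℤ)))) = d + (0, -(2 * (a : ℤ))) by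
          ext <;> push_cast <;> simp; ring]
  obtain ⟨e₁, e₂⟩ := e
  rcases hs with rfl | ⟨a, rfl, h₁, h₂⟩ | ⟨a, rfl, h₁, h₂⟩
  · simp
  · simp only at h₁ h₂
    rw [h₁, h₂, hU]
  · simp only at h₁ h₂
    rw [h₁, h₂, hV]

/-! ### Homogeneous components of chains -/

/-- The homogeneous component of bidegree `d` of a chain. -/
noncomputable def mcomp (C : PreCx) (d : ℤ × ℤ) (x : Msub C) : Msub C :=
  Finsupp.equivFunOnFinite.symm fun j => gcomp (d - C.gr j) (x j)

section
variable {C : PreCx}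

theorem mcomp_apply (d : ℤ × ℤ) (x : Msub C) (j : Fin C.n) :
    mcomp C d x j = gcomp (d - C.gr j) (x j) := rfl

theorem mcomp_add (d : ℤ × ℤ) (x y : Msub C) : mcomp C d (x + y) = mcomp C d x + mcomp C d y := by
  ext j
  simp [mcomp_apply, gcomp_add]

@[simp] theorem mcomp_zero (d : ℤ × ℤ) : mcomp C d 0 = 0 := by
  ext j
  simp [mcomp_apply]

theorem mcomp_sub (d : ℤ × ℤ) (x y : Msub C) : mcomp C d (x - y) = mcomp C d x - mcomp C d y := by
  rw [eq_sub_iff_add_eq, ← mcomp_add, sub_add_cancel]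

theorem mcomp_mcomp (d e : ℤ × ℤ) (x : Msub C) :
    mcomp C d (mcomp C e x) = if d = e then mcomp C e x else 0 := by
  ext j
  rw [mcomp_apply, mcomp_apply, gcomp_gcomp]
  by_cases h : d = e <;> simp [h, mcomp_apply]

theorem mcomp_smul_of_isHomog {s : RUV} {e : ℤ × ℤ} (hs : IsHomog s e.1 e.2) (d : ℤ × ℤ)
    (x : Msub C) : mcomp C (d + e) (s • x) = s • mcomp C d x := by
  ext j
  rw [mcomp_apply, Finsupp.smul_apply, Finsupp.smul_apply, mcomp_apply, smul_eq_mul, smul_eq_mul,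
    mul_comm, mul_comm s, show d + e - C.gr j = d - C.gr j + e by abel, gcomp_mul_of_isHomog hs]

theorem chainHomog_mcomp (d : ℤ × ℤ) (x : Msub C) : ChainHomog C (mcomp C d x) d.1 d.2 :=
  fun j => isHomog_gcomp (d - C.gr j) (x j)

theorem mcomp_eq_zero_of_lt (d : ℤ × ℤ) (h : ∀ j, (C.gr j).2 < d.2) (x : Msub C) :
    mcomp C d x = 0 := by
  ext j
  rcases chainHomog_mcomp d x j with h' | ⟨a, -, -, h'⟩ | ⟨a, -, -, h'⟩
  · exact h'
  · have := h j; omega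
  · have := h j; omega

theorem dmap_single (i : Fin C.n) (r : RUV) :
    dmap C (Finsupp.single i r) = r • ∑ j, Finsupp.single j (C.dm i j) := by
  simp [dmap, Finsupp.linearCombination_single]

theorem dmap_apply (x : Msub C) (k : Fin C.n) : dmap C x k = ∑ i, x i * C.dm i k := by
  rw [dmap, Finsupp.linearCombination_apply, Finsupp.sum_fintype _ _ (by simp)]
  simp [Finsupp.finsetSum_apply, Finsupp.single_apply]

theorem gcomp_sum {ι : Type*} (s : Finset ι) (d : ℤ × ℤ) (f : ι → RUV) :
    gcomp d (∑ i ∈ s, f i) = ∑ i ∈ s, gcomp d (f i) :=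
  map_sum (⟨⟨gcomp d, gcomp_zero d⟩, gcomp_add d⟩ : RUV →+ RUV) f s

theorem mcomp_dmap (hC : IsKnotLike C) (d : ℤ × ℤ) (x : Msub C) :
    mcomp C (d + (-1, -1)) (dmap C x) = dmap C (mcomp C d x) := by
  ext k
  rw [mcomp_apply, dmap_apply, dmap_apply, gcomp_sum]
  refine Finset.sum_congr rfl fun i _ => ?_
  rw [mcomp_apply]
  have h : IsHomog (C.dm i k) (C.gr i + (-1, -1) - C.gr k).1 (C.gr i + (-1, -1) - C.gr k).2 := by
    simpa [sub_eq_add_neg] using hC.dhomog i k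
  rw [← gcomp_mul_of_isHomog h]
  congr 1
  abel

/-- Every chain is a finite sum of its homogeneous components. -/
theorem exists_sum_mcomp (x : Msub C) :
    ∃ S : Finset (ℤ × ℤ), ∀ S', S ⊆ S' → ∑ d ∈ S', mcomp C d x = x := by
  have shift : ∀ (t : RUV) (e : ℤ × ℤ) (_ : IsHomog t e.1 e.2) (y : Msub C),
      (∃ S : Finset (ℤ × ℤ), ∀ S', S ⊆ S' → ∑ d ∈ S', mcomp C d y = y) →
      ∃ S : Finset (ℤ × ℤ), ∀ S', S ⊆ S' → ∑ d ∈ S', mcomp C d (t • y) = t • y := by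
    rintro t e ht y ⟨S, hS⟩
    refine ⟨S.map (addRightEmbedding e), fun S' hS' => ?_⟩
    have : ∀ d, mcomp C d (t • y) = t • mcomp C (d - e) y := fun d => by
      rw [← mcomp_smul_of_isHomog ht, sub_add_cancel]
    simp only [this, ← Finset.smul_sum]
    congr 1
    refine Eq.trans ?_ (hS (S'.map (addRightEmbedding (-e))) ?_)
    · rw [Finset.sum_map]
      simp [sub_eq_add_neg]
    · intro d hd
      refine Finset.mem_map.2 ⟨d + e, hS' (Finset.mem_map.2 ⟨d, hd, rfl⟩), ?_⟩
      simp
  induction x using Finsupp.induction_linear with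
  | zero => exact ⟨∅, fun S' _ => by simp⟩
  | add x y hx hy =>
    obtain ⟨S, hS⟩ := hx
    obtain ⟨T, hT⟩ := hy
    refine ⟨S ∪ T, fun S' h => ?_⟩
    simp only [mcomp_add, Finset.sum_add_distrib]
    rw [hS _ (Finset.union_subset_left h), hT _ (Finset.union_subset_right h)]
  | single j r =>
    induction r using RUV_induction with
    | zero => exact ⟨∅, fun S' _ => by simp⟩
    | one =>
      refine ⟨{C.gr j}, fun S' hS' => ?_⟩
      have : ∀ d, mcomp C d (Finsupp.single j 1) =
          if d = C.gr j then Finsupp.single j 1 else 0 := by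
        intro d
        ext i
        rw [mcomp_apply]
        by_cases hij : j = i
        · subst hij
          simp only [Finsupp.single_eq_same, gcomp_one, sub_eq_zero]
          split_ifs <;> simp
        · rw [Finsupp.single_apply, if_neg hij, gcomp_zero]
          split_ifs <;> simp [hij]
      simp only [this, Finset.sum_ite_eq']
      rw [if_pos (hS' (Finset.mem_singleton_self _))]
    | add r s hr hs =>
      obtain ⟨S, hS⟩ := hr
      obtain ⟨T, hT⟩ := hs
      refine ⟨S ∪ T, fun S' h => ?_⟩
      simp only [Finsupp.single_add, mcomp_add, Finset.sum_add_distrib]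
      rw [hS _ (Finset.union_subset_left h), hT _ (Finset.union_subset_right h)]
    | mulU r hr =>
      rw [← smul_eq_mul, ← Finsupp.smul_single]
      exact shift Uv (-2, 0) (Or.inr (Or.inl ⟨1, by simp, by simp, rfl⟩)) _ hr
    | mulV r hr =>
      rw [← smul_eq_mul, ← Finsupp.smul_single]
      exact shift Vv (0, -2) (Or.inr (Or.inr ⟨1, by simp, rfl, by simp⟩)) _ hr

theorem mem_of_mcomp_mem (N : Submodule RUV (Msub C)) {x : Msub C} (h : ∀ d, mcomp C d x ∈ N) :
    x ∈ N := by
  obtain ⟨S, hS⟩ := exists_sum_mcomp x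
  rw [← hS S subset_rfl]
  exact N.sum_mem fun d _ => h d
/-- The submodule `t·C ⊆ C`. -/
noncomputable def mulSub (C : PreCx) (t : RUV) : Submodule RUV (Msub C) :=
  LinearMap.range (LinearMap.lsmul RUV (Msub C) t)

theorem smul_mem_mulSub (t : RUV) (x : Msub C) : t • x ∈ mulSub C t := ⟨x, rfl⟩

theorem pow_smul_mem_mulSub (t : RUV) {m : ℕ} (hm : m ≠ 0) (x : Msub C) :
    t ^ m • x ∈ mulSub C t := by
  obtain ⟨m, rfl⟩ := Nat.exists_eq_succ_of_ne_zero hm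
  rw [pow_succ', mul_smul]
  exact smul_mem_mulSub _ _

theorem mem_mulSub_iff_dvd {t : RUV} {x : Msub C} : x ∈ mulSub C t ↔ ∀ j, t ∣ x j := by
  constructor
  · rintro ⟨e, rfl⟩ j
    exact ⟨e j, rfl⟩
  · intro h
    choose e he using h
    exact ⟨Finsupp.equivFunOnFinite.symm e, by ext j; simp [he]⟩

theorem mem_mulSub_of_tv_smul (i : ℕ) {x : Msub C} (h : tv i • x ∈ mulSub C (tv (i + 1))) :
    x ∈ mulSub C (tv (i + 1)) := by
  obtain ⟨e, he⟩ := h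
  refine mem_mulSub_iff_dvd.2 fun j => tv_dvd_of_mul_eq i (s := e j) ?_
  simpa using (DFunLike.congr_fun he j).symm

theorem tv_smul_eq_zero (i : ℕ) {x : Msub C} (h : x ∈ mulSub C (tv (i + 1))) : tv i • x = 0 := by
  obtain ⟨e, rfl⟩ := h
  rw [LinearMap.lsmul_apply, smul_smul, tv_mul_succ, zero_smul]

theorem eq_zero_of_mem_mulSub (i : ℕ) {x : Msub C} (h : x ∈ mulSub C (tv i))
    (h' : x ∈ mulSub C (tv (i + 1))) : x = 0 := by
  obtain ⟨e, rfl⟩ := h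
  exact tv_smul_eq_zero i (mem_mulSub_of_tv_smul i h')

theorem dmap_mem_mulSub {t : RUV} {x : Msub C} (h : x ∈ mulSub C t) :
    dmap C x ∈ mulSub C t := by
  obtain ⟨e, rfl⟩ := h
  exact ⟨dmap C e, by simp⟩

/-! ### Tower generators -/

/-- Chains whose class in `H_*(C/U)` is `V`-torsion (or which bound in `C/U`). -/
def torU (C : PreCx) : Submodule RUV (Msub C) where
  carrier := {z | ∃ k : ℕ, Vv ^ k • z ∈ bdryU C}
  zero_mem' := ⟨0, by simp⟩
  add_mem' := by
    rintro a b ⟨k, hk⟩ ⟨l, hl⟩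
    refine ⟨k + l, ?_⟩
    rw [smul_add]
    refine add_mem ?_ ?_
    · rw [pow_add, mul_comm, mul_smul]
      exact Submodule.smul_mem _ _ hk
    · rw [pow_add, mul_smul]
      exact Submodule.smul_mem _ _ hl
  smul_mem' := by
    rintro c x ⟨k, hk⟩
    exact ⟨k, by rw [smul_comm]; exact Submodule.smul_mem _ _ hk⟩

theorem bdryU_le_torU : bdryU C ≤ torU C := fun z hz => ⟨0, by simpa using hz⟩

theorem mem_torU_of_Vv_smul {m : ℕ} {z : Msub C} (h : Vv ^ m • z ∈ torU C) : z ∈ torU C := by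
  obtain ⟨k, hk⟩ := h
  exact ⟨k + m, by rwa [pow_add, mul_smul]⟩

theorem uSub_le_torU : uSub C ≤ torU C := le_sup_left.trans bdryU_le_torU

theorem dmap_mem_torU (x : Msub C) : dmap C x ∈ torU C :=
  bdryU_le_torU (Submodule.mem_sup_right ⟨x, rfl⟩)

theorem isVTowerGen_iff {x : Msub C} : IsVTowerGen C x ↔ dmap C x ∈ uSub C ∧ x ∉ torU C ∧
    ∀ z : Msub C, dmap C z ∈ uSub C → ∃ r : RUV, z - r • x ∈ torU C := by
  refine and_congr_right fun _ => and_congr ?_ Iff.rfl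
  exact not_exists.symm

theorem IsVTowerGen.of_sub_smul_mem {x w : Msub C} {r : RUV} (hx : IsVTowerGen C x)
    (hw : dmap C w ∈ uSub C) (h : x - r • w ∈ torU C) : IsVTowerGen C w := by
  rw [isVTowerGen_iff] at hx ⊢
  obtain ⟨-, h₂, h₃⟩ := hx
  refine ⟨hw, fun hwt => h₂ ?_, fun z hz => ?_⟩
  · simpa using add_mem h (Submodule.smul_mem _ r hwt)
  · obtain ⟨s, hs⟩ := h₃ z hz
    refine ⟨s * r, ?_⟩
    convert add_mem hs (Submodule.smul_mem _ s h) using 1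
    module

theorem IsVTowerGen.add {x w : Msub C} (hx : IsVTowerGen C x) (hw : dmap C w ∈ uSub C)
    (h : w ∈ torU C) : IsVTowerGen C (x + w) := by
  refine hx.of_sub_smul_mem (r := 1) ?_ ?_
  · rw [map_add]
    exact add_mem hx.1 hw
  · simpa using h

theorem isHomog_Vv_pow (k : ℕ) : IsHomog (Vv ^ k) ((0, -(2 * (k : ℤ))) : ℤ × ℤ).1
    ((0, -(2 * (k : ℤ))) : ℤ × ℤ).2 :=
  Or.inr (Or.inr ⟨k, rfl, rfl, rfl⟩)

theorem isHomog_Uv_pow (k : ℕ) : IsHomog (Uv ^ k) ((-(2 * (k : ℤ)), 0) : ℤ × ℤ).1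
    ((-(2 * (k : ℤ)), 0) : ℤ × ℤ).2 :=
  Or.inr (Or.inl ⟨k, rfl, rfl, rfl⟩)

theorem mcomp_smul_of_isHomog' {s : RUV} {e : ℤ × ℤ} (hs : IsHomog s e.1 e.2) (d : ℤ × ℤ)
    (x : Msub C) : mcomp C d (s • x) = s • mcomp C (d - e) x := by
  rw [← mcomp_smul_of_isHomog hs, sub_add_cancel]

theorem mcomp_mem_mulSub (i : ℕ) (d : ℤ × ℤ) {x : Msub C} (h : x ∈ mulSub C (tv i)) :
    mcomp C d x ∈ mulSub C (tv i) := by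
  obtain ⟨e, rfl⟩ := h
  rw [LinearMap.lsmul_apply]
  rcases tv_eq_or i with ⟨h, -⟩ | ⟨h, -⟩ <;> rw [h]
  · rw [← pow_one Uv, mcomp_smul_of_isHomog' (isHomog_Uv_pow 1), pow_one]
    exact smul_mem_mulSub _ _
  · rw [← pow_one Vv, mcomp_smul_of_isHomog' (isHomog_Vv_pow 1), pow_one]
    exact smul_mem_mulSub _ _

theorem mcomp_mem_bdryU (hC : IsKnotLike C) (d : ℤ × ℤ) {x : Msub C} (h : x ∈ bdryU C) :
    mcomp C d x ∈ bdryU C := by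
  obtain ⟨y, hy, z, ⟨w, rfl⟩, rfl⟩ := Submodule.mem_sup.1 h
  rw [mcomp_add]
  refine add_mem (Submodule.mem_sup_left (mcomp_mem_mulSub 0 d hy)) (Submodule.mem_sup_right ?_)
  refine ⟨mcomp C (d - (-1, -1)) w, ?_⟩
  rw [← mcomp_dmap hC, sub_add_cancel]

theorem mcomp_mem_torU (hC : IsKnotLike C) (d : ℤ × ℤ) {x : Msub C} (h : x ∈ torU C) :
    mcomp C d x ∈ torU C := by
  obtain ⟨k, hk⟩ := h
  refine ⟨k, ?_⟩
  rw [← mcomp_smul_of_isHomog (isHomog_Vv_pow k)]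
  exact mcomp_mem_bdryU hC _ hk

theorem mcomp_smul_mem (N : Submodule RUV (Msub C)) {z : Msub C} {q₀ : ℤ}
    (h : ∀ d : ℤ × ℤ, q₀ ≤ d.2 → mcomp C d z ∈ N) (r : RUV) (d : ℤ × ℤ) (hd : q₀ ≤ d.2) :
    mcomp C d (r • z) ∈ N := by
  induction r using RUV_induction generalizing d with
  | zero => simp
  | one => simpa using h d hd
  | add r s hr hs => rw [add_smul, mcomp_add]; exact add_mem (hr d hd) (hs d hd)
  | mulU r hr =>
    rw [mul_smul, ← pow_one Uv, mcomp_smul_of_isHomog' (isHomog_Uv_pow 1)]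
    exact N.smul_mem _ (hr _ (by simpa using hd))
  | mulV r hr =>
    rw [mul_smul, ← pow_one Vv, mcomp_smul_of_isHomog' (isHomog_Vv_pow 1)]
    exact N.smul_mem _ (hr _ (by simp; omega))

/-- A graded form of Nakayama's lemma. -/
theorem mem_of_sub_Vv_smul_mem {N : Submodule RUV (Msub C)}
    (hN : ∀ d, ∀ x ∈ N, mcomp C d x ∈ N) {z : Msub C} (r : RUV)
    (h : z - Vv • r • z ∈ N) : z ∈ N := by
  obtain ⟨B, hB⟩ : ∃ B : ℤ, ∀ j, (C.gr j).2 < B := by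
    obtain ⟨B, hB⟩ := (Set.finite_range fun j => (C.gr j).2).bddAbove
    exact ⟨B + 1, fun j => Int.lt_add_one_of_le (hB ⟨j, rfl⟩)⟩
  have key : ∀ n : ℕ, ∀ d : ℤ × ℤ, B - n ≤ d.2 → mcomp C d z ∈ N := by
    intro n
    induction n with
    | zero =>
      intro d hd
      rw [mcomp_eq_zero_of_lt d fun j => (hB j).trans_le (by simpa using hd)]
      exact N.zero_mem
    | succ n ih =>
      intro d hd
      have h1 := hN d _ h
      rw [mcomp_sub, ← pow_one Vv, mcomp_smul_of_isHomog' (isHomog_Vv_pow 1)] at h1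
      have h2 := N.smul_mem (Vv ^ 1) (mcomp_smul_mem N ih r (d - (0, -(2 * ((1 : ℕ) : ℤ)))) (by
        push_cast at hd
        simp
        omega))
      simpa using add_mem h1 h2
  refine mem_of_mcomp_mem N fun d => key (B - d.2).toNat d ?_
  omega

theorem IsVTowerGen.not_eq (hC : IsKnotLike C) {x : Msub C} (hx : IsVTowerGen C x)
    (e g h : Msub C) : x ≠ Uv • e + Vv • g + dmap C h := by
  intro he
  have hx' := isVTowerGen_iff.1 hx
  have hg : dmap C g ∈ uSub C := by
    refine mem_mulSub_of_tv_smul 1 (x := dmap C g) ?_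
    have h1 : dmap C x = Uv • dmap C e + Vv • dmap C g := by
      rw [he]
      simp [hC.dsq]
    have h2 := sub_mem hx'.1 (smul_mem_mulSub Uv (dmap C e))
    rw [h1, add_sub_cancel_left] at h2
    exact h2
  obtain ⟨r, hr⟩ := hx'.2.2 g hg
  refine hx'.2.1 (mem_of_sub_Vv_smul_mem (fun d x hx => mcomp_mem_torU hC d hx) r ?_)
  have h3 : x - Vv • r • x = (Uv • e + dmap C h) + Vv • (g - r • x) := by
    refine sub_eq_iff_eq_add.2 (he.trans ?_)
    module
  rw [h3]
  exact add_mem (add_mem (uSub_le_torU ⟨e, rfl⟩) (dmap_mem_torU h)) (Submodule.smul_mem _ _ hr)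

/-- Some homogeneous component of a tower generator is a tower generator. -/
theorem IsVTowerGen.exists_mcomp (hC : IsKnotLike C) {x : Msub C} (hx : IsVTowerGen C x) :
    ∃ s : ℤ, IsVTowerGen C (mcomp C (0, s) x) := by
  have hx' := isVTowerGen_iff.1 hx
  have hcyc : ∀ d, dmap C (mcomp C d x) ∈ uSub C := fun d => by
    rw [← mcomp_dmap hC]
    exact mcomp_mem_mulSub 0 _ hx'.1
  choose r hr using fun d => hx'.2.2 _ (hcyc d)
  obtain ⟨d, hd⟩ : ∃ d, augm (r d) = 1 := by
    by_contra hcon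
    have h0 : ∀ d, augm (r d) = 0 := fun d => by
      have : ∀ a : ZMod 2, a ≠ 1 → a = 0 := by decide
      exact this _ fun h => hcon ⟨d, h⟩
    have hmem : x ∈ torU C ⊔ (Submodule.span RUV {Vv • x}) := by
      refine mem_of_mcomp_mem _ fun d => ?_
      obtain ⟨s, t, hst, -⟩ := exists_eq_of_augm (r d)
      have h1 : mcomp C d x = (mcomp C d x - r d • x + Uv • s • x) + t • Vv • x := by
        rw [hst (h0 d)]
        module
      rw [h1]
      exact Submodule.add_mem_sup (add_mem (hr d) (uSub_le_torU ⟨_, rfl⟩))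
        (Submodule.smul_mem _ _ (Submodule.mem_span_singleton_self _))
    obtain ⟨y, hy, z, hz, hyz⟩ := Submodule.mem_sup.1 hmem
    obtain ⟨t, rfl⟩ := Submodule.mem_span_singleton.1 hz
    refine hx'.2.1 (mem_of_sub_Vv_smul_mem (fun d x hx => mcomp_mem_torU hC d hx) t ?_)
    rw [smul_comm, sub_eq_of_eq_add hyz.symm]
    exact hy
  obtain ⟨s, t, -, hst⟩ := exists_eq_of_augm (r d)
  have hst := hst hd
  set w := mcomp C d x with hw
  have hN : ∀ e, ∀ y ∈ torU C ⊔ Submodule.span RUV {w},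
      mcomp C e y ∈ torU C ⊔ Submodule.span RUV {w} := by
    intro e y hy
    obtain ⟨y₁, hy₁, z, hz, rfl⟩ := Submodule.mem_sup.1 hy
    obtain ⟨c, rfl⟩ := Submodule.mem_span_singleton.1 hz
    rw [mcomp_add]
    refine Submodule.add_mem_sup (mcomp_mem_torU hC _ hy₁)
      (mcomp_smul_mem _ (q₀ := e.2) ?_ c e le_rfl)
    intro d' _
    rw [hw, mcomp_mcomp]
    split_ifs
    · exact Submodule.mem_span_singleton_self _
    · exact zero_mem _
  have hxw : x ∈ torU C ⊔ Submodule.span RUV {w} := by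
    refine mem_of_sub_Vv_smul_mem hN (-t) ?_
    have h1 : x - Vv • (-t) • x = -(w - r d • x + Uv • s • x) + w := by
      rw [hst]
      module
    rw [h1]
    exact Submodule.add_mem_sup (neg_mem (add_mem (hr d) (uSub_le_torU ⟨_, rfl⟩)))
      (Submodule.mem_span_singleton_self _)
  obtain ⟨y, hy, z, hz, hyz⟩ := Submodule.mem_sup.1 hxw
  obtain ⟨c, rfl⟩ := Submodule.mem_span_singleton.1 hz
  have hwt : IsVTowerGen C w :=
    hx.of_sub_smul_mem (r := c) (hcyc d) (by rw [sub_eq_of_eq_add hyz.symm]; exact hy)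
  have hd1 : d.1 = 0 := hC.vTowerGr w d.1 d.2 (chainHomog_mcomp d x) hwt.1 hwt.2.1
  refine ⟨d.2, ?_⟩
  rw [← hd1]
  exact hwt
theorem Msub_add_self (x : Msub C) : x + x = 0 := by
  ext j
  exact RUV_add_self _

/-- `x` and `y` are joined, modulo the other variable, by the `i`-th arrow of a standard
complex with parameter `b`. -/
def Arr (C : PreCx) (i : ℕ) (b : ℤ) (x y : Msub C) : Prop :=
  (b < 0 → dmap C x - tv i ^ b.natAbs • y ∈ mulSub C (tv (i + 1)) ∧
    dmap C y ∈ mulSub C (tv (i + 1))) ∧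
  (0 < b → dmap C x ∈ mulSub C (tv (i + 1)) ∧
    dmap C y - tv i ^ b.natAbs • x ∈ mulSub C (tv (i + 1)))

theorem arr_of_neg {i : ℕ} {b : ℤ} (hb : b < 0) {x y : Msub C} : Arr C i b x y ↔
    dmap C x - tv i ^ b.natAbs • y ∈ mulSub C (tv (i + 1)) ∧
      dmap C y ∈ mulSub C (tv (i + 1)) :=
  ⟨fun h => h.1 hb, fun h => ⟨fun _ => h, fun h' => absurd h' hb.not_gt⟩⟩

theorem arr_of_pos {i : ℕ} {b : ℤ} (hb : 0 < b) {x y : Msub C} : Arr C i b x y ↔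
    dmap C x ∈ mulSub C (tv (i + 1)) ∧
      dmap C y - tv i ^ b.natAbs • x ∈ mulSub C (tv (i + 1)) :=
  ⟨fun h => h.2 hb, fun h => ⟨fun h' => absurd h' hb.not_gt, fun _ => h⟩⟩

theorem arr_zero (i : ℕ) (b : ℤ) : Arr C i b 0 0 := by
  simp [Arr]

theorem arr_add_even (i : ℕ) {p : ℕ} (hp : Even p) (b : ℤ) (x y : Msub C) :
    Arr C (i + p) b x y ↔ Arr C i b x y := by
  rw [Arr, Arr, add_right_comm, tv_add_even i hp, tv_add_even (i + 1) hp]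

theorem Arr.add {i : ℕ} {b : ℤ} {x y x' y' : Msub C} (h : Arr C i b x y) (h' : Arr C i b x' y') :
    Arr C i b (x + x') (y + y') := by
  refine ⟨fun hb => ⟨?_, ?_⟩, fun hb => ⟨?_, ?_⟩⟩
  · convert add_mem (h.1 hb).1 (h'.1 hb).1 using 1
    rw [map_add]; module
  · rw [map_add]; exact add_mem (h.1 hb).2 (h'.1 hb).2
  · rw [map_add]; exact add_mem (h.2 hb).1 (h'.2 hb).1
  · convert add_mem (h.2 hb).2 (h'.2 hb).2 using 1
    rw [map_add]; module

/-- The target of an arrow may be changed by a multiple of the other variable. -/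
theorem Arr.add_right {i : ℕ} {b : ℤ} {x y δ : Msub C} (h : Arr C i b x y)
    (hδ : δ ∈ mulSub C (tv (i + 1))) : Arr C i b x (y + δ) := by
  have h0 : Arr C i b 0 δ := by
    have hδ' := dmap_mem_mulSub hδ
    refine ⟨fun hb => ⟨?_, hδ'⟩, fun hb => ⟨by simp, by simpa using hδ'⟩⟩
    rw [map_zero, zero_sub]
    exact neg_mem (Submodule.smul_mem _ _ hδ)
  simpa using h.add h0

/-- The chains which can be reached from a tower generator along arrows with parameters
`b 0, …, b (i - 1)`. -/
def reach (C : PreCx) (b : ℕ → ℤ) : ℕ → Set (Msub C)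
  | 0 => {x | IsVTowerGen C x}
  | i + 1 => {y | ∃ x ∈ reach C b i, Arr C i (b i) x y}

theorem reach_congr {b c : ℕ → ℤ} {n : ℕ} (h : ∀ i < n, b i = c i) :
    reach C b n = reach C c n := by
  induction n with
  | zero => rfl
  | succ n ih =>
    rw [reach, reach, ih fun i hi => h i (by omega), h n (by omega)]

theorem reach_add {b : ℕ → ℤ} {i : ℕ} {x δ : Msub C} (hx : x ∈ reach C b i)
    (hδ : δ ∈ mulSub C (tv i)) : x + δ ∈ reach C b i := by
  cases i with
  | zero => exact IsVTowerGen.add hx (dmap_mem_mulSub hδ) (uSub_le_torU hδ)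
  | succ i =>
    obtain ⟨x', hx', h⟩ := hx
    exact ⟨x', hx', h.add_right hδ⟩


theorem qval_injective_of_ne_zero {b c : ℤ} (hb : b ≠ 0) (hc : c ≠ 0)
    (h : qval b = qval c) : b = c := by
  rw [qval, qval, if_neg hb, if_neg hc, one_div, one_div] at h
  exact_mod_cast inv_injective h

theorem qval_lt_cases {b c : ℤ} (hb : b ≠ 0) (hc : c ≠ 0) (h : qval c < qval b) :
    (c < 0 ∧ 0 < b) ∨ (0 < b ∧ b < c) ∨ (b < c ∧ c < 0) := by
  rw [qval, qval, if_neg hb, if_neg hc] at h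
  rcases lt_or_gt_of_ne hb with hb' | hb' <;> rcases lt_or_gt_of_ne hc with hc' | hc'
  · right; right
    have h1 : (b : ℚ) < 0 := by exact_mod_cast hb'
    have h2 : (c : ℚ) < 0 := by exact_mod_cast hc'
    rw [one_div_lt_one_div_of_neg h2 h1] at h
    exact ⟨by exact_mod_cast h, hc'⟩
  · exfalso
    have h1 : (b : ℚ) < 0 := by exact_mod_cast hb'
    have h2 : (0 : ℚ) < c := by exact_mod_cast hc'
    have := one_div_neg.2 h1
    have := one_div_pos.2 h2
    linarith
  · exact Or.inl ⟨hc', hb'⟩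
  · right; left
    have h1 : (0 : ℚ) < b := by exact_mod_cast hb'
    have h2 : (0 : ℚ) < c := by exact_mod_cast hc'
    rw [one_div_lt_one_div h2 h1] at h
    exact ⟨hb', by exact_mod_cast h⟩

/-- Of two arrows with distinct parameters, the one with the larger parameter absorbs the
target of the other after modifying its source. -/
theorem Arr.exists_merge {i : ℕ} {b c : ℤ} (hb : b ≠ 0) (hc : c ≠ 0) (h : qval c < qval b)
    {x y v w : Msub C} (hx : Arr C i b x y) (hv : Arr C i c v w) :
    ∃ δ ∈ mulSub C (tv i), Arr C i b (x + δ) (y + w) := by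
  rcases qval_lt_cases hb hc h with ⟨hc', hb'⟩ | ⟨hb', hbc⟩ | ⟨hbc, hc'⟩
  · rw [arr_of_pos hb'] at hx
    rw [arr_of_neg hc'] at hv
    refine ⟨0, zero_mem _, (arr_of_pos hb').2 ⟨by simpa using hx.1, ?_⟩⟩
    convert add_mem hx.2 hv.2 using 1
    rw [map_add]; module
  · rw [arr_of_pos hb'] at hx
    rw [arr_of_pos (hb'.trans hbc)] at hv
    refine ⟨tv i ^ (c.natAbs - b.natAbs) • v, pow_smul_mem_mulSub _ (by omega) _,
      (arr_of_pos hb').2 ⟨?_, ?_⟩⟩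
    · rw [map_add, map_smul]
      exact add_mem hx.1 (Submodule.smul_mem _ _ hv.1)
    · convert add_mem hx.2 hv.2 using 1
      rw [map_add, smul_add, smul_smul, ← pow_add,
        show b.natAbs + (c.natAbs - b.natAbs) = c.natAbs by omega]
      module
  · have hb' := hbc.trans hc'
    rw [arr_of_neg hb'] at hx
    rw [arr_of_neg hc'] at hv
    refine ⟨tv i ^ (b.natAbs - c.natAbs) • v, pow_smul_mem_mulSub _ (by omega) _,
      (arr_of_neg hb').2 ⟨?_, ?_⟩⟩
    · convert add_mem hx.1 (Submodule.smul_mem _ (tv i ^ (b.natAbs - c.natAbs)) hv.1) using 1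
      rw [map_add, map_smul, smul_sub, smul_smul, ← pow_add,
        show b.natAbs - c.natAbs + c.natAbs = b.natAbs by omega]
      module
    · rw [map_add]; exact add_mem hx.2 hv.2

/-- The merge lemma: the sum of chains reached after `i` and `i + p` steps is again reached
after `i` or `i + p` steps. -/
theorem reach_merge {b : ℕ → ℤ} {p : ℕ} (hp : Even p) (hp0 : p ≠ 0) {i : ℕ}
    (hb : ∀ l < i + p, b l ≠ 0) {x w : Msub C} (hx : x ∈ reach C b i)
    (hw : w ∈ reach C b (i + p)) : x + w ∈ reach C b i ∨ x + w ∈ reach C b (i + p) := by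
  induction i generalizing x w with
  | zero =>
    obtain ⟨q, rfl⟩ := Nat.exists_eq_succ_of_ne_zero hp0
    have hq : tv q = Vv ∧ tv (q + 1) = Uv := by
      have : (q + 1) % 2 = 0 := Nat.even_iff.1 hp
      have h' : q % 2 = 1 := by omega
      simp [tv, this, h']
    rw [Nat.zero_add] at hw hb ⊢
    obtain ⟨v, hv, h⟩ := hw
    rcases lt_or_gt_of_ne (hb q (Nat.lt_succ_self q)) with hq0 | hq0
    · left
      rw [arr_of_neg hq0, hq.1, hq.2] at h
      refine IsVTowerGen.add hx h.2 (mem_torU_of_Vv_smul (m := (b q).natAbs) ?_)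
      have := sub_mem (dmap_mem_torU v) (uSub_le_torU h.1)
      rwa [sub_sub_cancel] at this
    · right
      refine ⟨v, hv, ?_⟩
      rw [arr_of_pos hq0, hq.1, hq.2] at h ⊢
      refine ⟨h.1, ?_⟩
      rw [map_add, add_sub_assoc]
      exact add_mem hx.1 h.2
  | succ i ih =>
    rw [add_right_comm] at hw hb ⊢
    obtain ⟨x', hx', hxx⟩ := hx
    obtain ⟨w', hw', hww⟩ := hw
    have hbi : b i ≠ 0 := hb i (by omega)
    have hbip : b (i + p) ≠ 0 := hb _ (by omega)
    rw [arr_add_even i hp] at hww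
    rcases lt_trichotomy (qval (b (i + p))) (qval (b i)) with h | h | h
    · left
      obtain ⟨δ, hδ, h'⟩ := hxx.exists_merge hbi hbip h hww
      exact ⟨_, reach_add hx' hδ, h'⟩
    · have heq : b (i + p) = b i := qval_injective_of_ne_zero hbip hbi h
      rcases ih (fun l hl => hb l (by omega)) hx' hw' with h' | h'
      · left
        exact ⟨_, h', hxx.add (heq ▸ hww)⟩
      · right
        refine ⟨_, h', ?_⟩
        rw [arr_add_even i hp, heq]
        exact hxx.add (heq ▸ hww)
    · right
      obtain ⟨δ, hδ, h'⟩ := hww.exists_merge hbip hbi h hxx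
      refine ⟨_, reach_add hw' (δ := δ) (by rwa [tv_add_even i hp]), ?_⟩
      rw [arr_add_even i hp, add_comm x]
      exact h'

theorem qval_lt_of_pos {b c : ℤ} (hb : 0 < b) (h : b < c) : qval c < qval b := by
  rw [qval, qval, if_neg hb.ne', if_neg (hb.trans h).ne']
  have h1 : (0 : ℚ) < b := by exact_mod_cast hb
  exact one_div_lt_one_div_of_lt h1 (by exact_mod_cast h)

theorem qval_lt_of_neg {b c : ℤ} (hc : c < 0) (h : b < c) : qval c < qval b := by
  rw [qval, qval, if_neg hc.ne, if_neg (h.trans hc).ne]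
  have h1 : (c : ℚ) < 0 := by exact_mod_cast hc
  exact one_div_lt_one_div_of_neg_of_lt h1 (by exact_mod_cast h)

/-- If the parameters `a` are maximal, the chains reached along `a` are nonzero modulo `U`, `V`
and boundaries. -/
theorem reach_not_eq (hC : IsKnotLike C) {a : ℕ → ℤ} (ha : ∀ i, a i ≠ 0)
    (hmax : ∀ i b, b ≠ 0 → ∀ x ∈ reach C a i, ∀ y, Arr C i b x y → qval b ≤ qval (a i))
    {k : ℕ} {w : Msub C} (hw : w ∈ reach C a k) (e g h : Msub C) :
    w ≠ tv k • e + tv (k + 1) • g + dmap C h := by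
  induction k generalizing w e g h with
  | zero => exact IsVTowerGen.not_eq hC hw e g h
  | succ k ih =>
    intro hwe
    rw [tv_add_two] at hwe
    obtain ⟨x, hx, hxw⟩ := hw
    have hdw : dmap C w = tv (k + 1) • dmap C e + tv k • dmap C g := by
      rw [hwe]
      simp [hC.dsq]
    rcases lt_or_gt_of_ne (ha k) with h0 | h0
    · refine absurd (hmax k (a k - 1) (by omega) (x + tv k ^ (a k).natAbs • h)
        (reach_add hx (pow_smul_mem_mulSub _ (by omega) _)) g ?_)
        (not_le.2 (qval_lt_of_neg h0 (by omega)))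
      rw [arr_of_neg h0] at hxw
      refine (arr_of_neg (by omega)).2 ⟨?_, ?_⟩
      · convert add_mem hxw.1 (Submodule.smul_mem _ (tv k ^ (a k).natAbs)
          (smul_mem_mulSub (tv (k + 1)) e)) using 1
        have h2 : tv k ^ (a k).natAbs • dmap C h + tv k ^ (a k).natAbs • dmap C h = 0 :=
          Msub_add_self _
        rw [map_add, map_smul, show (a k - 1).natAbs = (a k).natAbs + 1 by omega, pow_succ, hwe,
          ← sub_eq_zero, ← h2]
        module
      · refine mem_mulSub_of_tv_smul k ?_
        have := sub_mem hxw.2 (smul_mem_mulSub (tv (k + 1)) (dmap C e))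
        rwa [hdw, add_sub_cancel_left] at this
    · rw [arr_of_pos h0] at hxw
      have h1 : dmap C g - tv k ^ ((a k).natAbs - 1) • x ∈ mulSub C (tv (k + 1)) := by
        refine mem_mulSub_of_tv_smul k ?_
        convert sub_mem hxw.2 (smul_mem_mulSub (tv (k + 1)) (dmap C e)) using 1
        rw [hdw, smul_sub, smul_smul, ← pow_succ', show (a k).natAbs - 1 + 1 = (a k).natAbs by omega]
        module
      rcases eq_or_ne (a k) 1 with h2 | h2
      · rw [h2] at h1
        obtain ⟨f, hf⟩ := h1
        refine ih hx 0 (-f) g ?_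
        rw [LinearMap.lsmul_apply] at hf
        rw [smul_zero, smul_neg, hf]
        simp
      · refine absurd (hmax k (a k - 1) (by omega) x hx g ((arr_of_pos (by omega)).2 ⟨hxw.1, ?_⟩))
          (not_le.2 (qval_lt_of_pos (by omega) (by omega)))
        rwa [show (a k - 1).natAbs = (a k).natAbs - 1 by omega]

theorem exists_arr_neg_one (hC : IsKnotLike C) {b : ℕ → ℤ} {k : ℕ} (hb : ∀ i < k, b i ≠ 0)
    {x : Msub C} (hx : x ∈ reach C b k) : ∃ y, Arr C k (-1) x y := by
  obtain ⟨y, z, hyz⟩ : ∃ y z, dmap C x = tv k • y + tv (k + 1) • z := by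
    cases k with
    | zero =>
      obtain ⟨y, hy⟩ := hx.1
      exact ⟨y, 0, by simpa [tv_zero] using hy.symm⟩
    | succ k =>
      obtain ⟨v, -, h⟩ := hx
      rw [tv_add_two]
      rcases lt_or_gt_of_ne (hb k (by omega)) with h0 | h0
      · obtain ⟨y, hy⟩ := ((arr_of_neg h0).1 h).2
        exact ⟨y, 0, by simpa using hy.symm⟩
      · obtain ⟨y, hy⟩ := ((arr_of_pos h0).1 h).2
        refine ⟨y, tv k ^ ((b k).natAbs - 1) • v, ?_⟩
        rw [LinearMap.lsmul_apply] at hy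
        rw [hy, smul_smul, ← pow_succ', show (b k).natAbs - 1 + 1 = (b k).natAbs by omega]
        module
  refine ⟨y, (arr_of_neg (by norm_num)).2 ⟨?_, mem_mulSub_of_tv_smul k ⟨-dmap C z, ?_⟩⟩⟩
  · rw [hyz]
    simpa using smul_mem_mulSub _ z
  · have := hC.dsq x
    rw [hyz, map_add, map_smul, map_smul] at this
    simpa [eq_comm] using eq_neg_of_add_eq_zero_left this

/-- The bidegree of `tv i ^ m`. -/
def tvDeg (i : ℕ) (m : ℕ) : ℤ × ℤ := if i % 2 = 0 then (-(2 * (m : ℤ)), 0) else (0, -(2 * (m : ℤ)))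

theorem isHomog_tv_pow (i m : ℕ) : IsHomog (tv i ^ m) (tvDeg i m).1 (tvDeg i m).2 := by
  unfold tv tvDeg
  split_ifs
  · exact isHomog_Uv_pow m
  · exact isHomog_Vv_pow m

theorem stepShift_of_neg (i : ℕ) {b : ℤ} (hb : b < 0) :
    stepShift i b = (-1, -1) - tvDeg i b.natAbs := by
  unfold stepShift tvDeg
  split_ifs <;> ext <;> simp <;> ring

theorem stepShift_of_pos (i : ℕ) {b : ℤ} (hb : 0 < b) :
    stepShift i b = (1, 1) + tvDeg i b.natAbs := by
  unfold stepShift tvDeg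
  rw [if_neg hb.not_gt, if_neg hb.not_gt]
  split_ifs <;> ext <;> simp <;> ring

theorem Arr.mcomp (hC : IsKnotLike C) {i : ℕ} {b : ℤ} {x y : Msub C}
    (h : Arr C i b x y) (d : ℤ × ℤ) :
    Arr C i b (_root_.mcomp C d x) (_root_.mcomp C (d + stepShift i b) y) := by
  refine ⟨fun hb => ?_, fun hb => ?_⟩
  · obtain ⟨h₁, h₂⟩ := h.1 hb
    rw [stepShift_of_neg i hb, ← mcomp_dmap hC, ← mcomp_dmap hC]
    refine ⟨?_, mcomp_mem_mulSub _ _ h₂⟩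
    have := mcomp_mem_mulSub _ (d + (-1, -1)) h₁
    rwa [mcomp_sub, mcomp_smul_of_isHomog' (isHomog_tv_pow _ _), add_sub_assoc] at this
  · obtain ⟨h₁, h₂⟩ := h.2 hb
    rw [stepShift_of_pos i hb, ← mcomp_dmap hC, ← mcomp_dmap hC]
    refine ⟨mcomp_mem_mulSub _ _ h₁, ?_⟩
    have := mcomp_mem_mulSub _ (d + tvDeg i b.natAbs) h₂
    rw [mcomp_sub, mcomp_smul_of_isHomog (isHomog_tv_pow _ _)] at this
    convert this using 3
    ext <;> simp <;> ring

/-- The bidegree of the `i`-th chain along a sequence of arrows starting in bidegree `(0, s)`. -/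
def chainDeg (b : ℕ → ℤ) (s : ℤ) (i : ℕ) : ℤ × ℤ :=
  (0, s) + ∑ k ∈ Finset.range i, stepShift k (b k)

/-- A sequence of arrows with parameters `b 0, …, b (n - 1)` starting at a tower generator. -/
structure IsPath (C : PreCx) (b : ℕ → ℤ) (n : ℕ) (y : ℕ → Msub C) : Prop where
  tower : IsVTowerGen C (y 0)
  arr : ∀ i < n, Arr C i (b i) (y i) (y (i + 1))

theorem IsPath.mem_reach {b : ℕ → ℤ} {n : ℕ} {y : ℕ → Msub C} (h : IsPath C b n y) {i : ℕ}
    (hi : i ≤ n) : y i ∈ reach C b i := by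
  induction i with
  | zero => exact h.tower
  | succ i ih => exact ⟨y i, ih (by omega), h.arr i (by omega)⟩

theorem exists_isPath {b : ℕ → ℤ} {n : ℕ} {w : Msub C} (hw : w ∈ reach C b n) :
    ∃ y, IsPath C b n y ∧ y n = w := by
  induction n generalizing w with
  | zero => exact ⟨fun _ => w, ⟨hw, by simp⟩, rfl⟩
  | succ n ih =>
    obtain ⟨x, hx, hxw⟩ := hw
    obtain ⟨y, hy, hyn⟩ := ih hx
    refine ⟨Function.update y (n + 1) w, ⟨?_, fun i hi => ?_⟩, by simp⟩
    · rw [Function.update_of_ne (by omega)]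
      exact hy.tower
    · rw [Function.update_of_ne (by omega)]
      rcases eq_or_ne i n with rfl | hin
      · rw [Function.update_self, hyn]
        exact hxw
      · rw [Function.update_of_ne (by omega)]
        exact hy.arr i (by omega)

theorem IsPath.exists_mcomp (hC : IsKnotLike C) {b : ℕ → ℤ} {n : ℕ} {y : ℕ → Msub C}
    (h : IsPath C b n y) : ∃ s, IsPath C b n fun i => mcomp C (chainDeg b s i) (y i) := by
  obtain ⟨s, hs⟩ := h.tower.exists_mcomp hC
  refine ⟨s, by simpa [chainDeg] using hs, fun i hi => ?_⟩
  have := (h.arr i hi).mcomp hC (chainDeg b s i)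
  rwa [chainDeg, add_assoc, ← Finset.sum_range_succ] at this

theorem stepShift_neg_one_add (k : ℕ) : stepShift k (-1) + stepShift (k + 1) (-1) = 0 := by
  rw [stepShift_of_neg _ (by norm_num), stepShift_of_neg _ (by norm_num)]
  unfold tvDeg
  rcases Nat.mod_two_eq_zero_or_one k with h | h
  · have : (k + 1) % 2 = 1 := by omega
    rw [h, this]; rfl
  · have : (k + 1) % 2 = 0 := by omega
    rw [h, this]; rfl

theorem eq_of_chainHomog {x y : Msub C} {d : ℤ × ℤ} (hx : ChainHomog C x d.1 d.2)
    (hy : ChainHomog C y d.1 d.2) (h : ∀ j, x j = 0 ↔ y j = 0) : x = y := by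
  ext j
  by_cases h0 : x j = 0
  · rw [h0, (h j).1 h0]
  · exact (hx j).eq_of_ne_zero (hy j) h0 (mt (h j).2 h0)

/-- Any reachable chain lies on a sequence of arrows that ends in zero, all further parameters
being `-1`. -/
theorem exists_zero_mem_reach (hC : IsKnotLike C) {b : ℕ → ℤ} {k : ℕ} (hb : ∀ i < k, b i ≠ 0)
    (h : (reach C b k).Nonempty) :
    ∃ M, ∀ j ≥ M, (0 : Msub C) ∈ reach C (fun i => if i < k then b i else -1) (k + j) := by
  classical
  set c : ℕ → ℤ := fun i => if i < k then b i else -1 with hc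
  have hc0 : ∀ i, c i ≠ 0 := by
    intro i
    by_cases hi : i < k
    · simpa [hc, hi] using hb i hi
    · simp [hc, hi]
  have hck : ∀ j, c (k + j) = -1 := by simp [hc]
  suffices ∃ M, (0 : Msub C) ∈ reach C c (k + M) by
    obtain ⟨M, hM⟩ := this
    refine ⟨M, fun j hj => ?_⟩
    induction j, hj using Nat.le_induction with
    | base => exact hM
    | succ j _ ih => exact ⟨0, ih, arr_zero _ _⟩
  have hne : ∀ j, (reach C c (k + j)).Nonempty := by
    intro j
    induction j with
    | zero => rwa [Nat.add_zero, reach_congr (c := b) fun i hi => by simp [hc, hi]]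
    | succ j ih =>
      obtain ⟨x, hx⟩ := ih
      obtain ⟨y, hy⟩ := exists_arr_neg_one hC (fun i _ => hc0 i) hx
      exact ⟨y, x, hx, by rwa [← hck j] at hy⟩
  obtain ⟨w, hw⟩ := hne (2 * 2 ^ C.n)
  obtain ⟨y, hy, -⟩ := exists_isPath hw
  obtain ⟨s, hs⟩ := hy.exists_mcomp hC
  have hdeg : ∀ l, chainDeg c s (k + 2 * l) = chainDeg c s k := by
    intro l
    induction l with
    | zero => rfl
    | succ l ih =>
      rw [← ih, chainDeg, show k + 2 * (l + 1) = k + 2 * l + 1 + 1 by ring, Finset.sum_range_succ,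
        Finset.sum_range_succ, hck, show k + 2 * l + 1 = k + (2 * l + 1) by ring, hck,
        add_assoc (Finset.sum _ _), ← add_assoc k, stepShift_neg_one_add, add_zero, ← chainDeg]
  set z : ℕ → Msub C := fun i => mcomp C (chainDeg c s i) (y i) with hz
  obtain ⟨l, l', hne, hll⟩ := Fintype.exists_ne_map_eq_of_card_lt
    (fun (l : Fin (2 ^ C.n + 1)) (j : Fin C.n) => decide (z (k + 2 * l) j = 0)) (by simp)
  wlog hlt : l < l' generalizing l l'
  · exact this l' l hne.symm hll.symm (lt_of_le_of_ne (not_lt.1 hlt) hne.symm)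
  have hlt' : (l : ℕ) < l' := hlt
  have heq : z (k + 2 * l) = z (k + 2 * l') := by
    refine eq_of_chainHomog (d := chainDeg c s k) ?_ ?_ fun j => by simpa using congrFun hll j
    · rw [← hdeg l]; exact chainHomog_mcomp _ _
    · rw [← hdeg l']; exact chainHomog_mcomp _ _
  have h1 := hs.mem_reach (i := k + 2 * l) (by omega)
  have h2 := hs.mem_reach (i := k + 2 * l + 2 * (l' - l)) (by omega)
  have h3 := reach_merge (by simp) (by omega) (fun i _ => hc0 i) h1 h2
  rw [show k + 2 * (l : ℕ) + 2 * (l' - l) = k + 2 * l' by omega] at h3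
  change z (k + 2 * l) + z (k + 2 * l') ∈ _ ∨ z (k + 2 * l) + z (k + 2 * l') ∈ _ at h3
  rw [heq, Msub_add_self] at h3
  exact h3.elim (fun h => ⟨_, h⟩) fun h => ⟨_, h⟩

theorem Uv_dvd_of_dvd_Vv_pow_mul {m : ℕ} {r : RUV} (h : Uv ∣ Vv ^ m * r) : Uv ∣ r := by
  induction m with
  | zero => simpa using h
  | succ m ih =>
    obtain ⟨s, hs⟩ := h
    exact ih (Uv_dvd_of_Vv_mul_eq (s := s) (by rw [← hs]; ring))

theorem dmap_single_one (i j : Fin C.n) : dmap C (Finsupp.single i 1) j = C.dm i j := by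
  rw [dmap_apply, Finset.sum_eq_single i]
  · simp
  · intro k _ hk
    simp [hk.symm]
  · simp

theorem single_mem_torU {s t : Fin C.n} {m : ℕ} (h : C.dm s t = Vv ^ m)
    (h' : ∀ j ≠ t, Uv ∣ C.dm s j) : Finsupp.single t 1 ∈ torU C := by
  refine mem_torU_of_Vv_smul (m := m) ?_
  have h1 : dmap C (Finsupp.single s 1) - Vv ^ m • Finsupp.single t 1 ∈ mulSub C Uv := by
    refine mem_mulSub_iff_dvd.2 fun j => ?_
    rw [Finsupp.sub_apply, dmap_single_one]
    by_cases hj : j = t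
    · simp [hj, h]
    · simpa [Finsupp.single_apply, Ne.symm hj] using h' j hj
  have := sub_mem (dmap_mem_torU (Finsupp.single s 1)) (uSub_le_torU h1)
  rwa [sub_sub_cancel] at this

theorem Uv_dvd_of_dmap_mem {s t : Fin C.n} {m : ℕ} (h : C.dm s t = Vv ^ m)
    (h' : ∀ i ≠ s, Uv ∣ C.dm i t) {z : Msub C} (hz : dmap C z ∈ uSub C) : Uv ∣ z s := by
  have h1 : Uv ∣ dmap C z t := mem_mulSub_iff_dvd.1 hz t
  rw [dmap_apply, ← Finset.add_sum_erase _ _ (Finset.mem_univ s), h] at h1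
  refine Uv_dvd_of_dvd_Vv_pow_mul (m := m) ?_
  rw [mul_comm]
  refine (dvd_add_left (Finset.dvd_sum fun i hi => ?_)).1 h1
  exact (h' i (Finset.ne_of_mem_erase hi)).mul_left _

theorem eq_sum_smul_single (z : Msub C) : z = ∑ i, z i • (Finsupp.single i 1 : Msub C) := by
  ext j
  rw [Finsupp.finsetSum_apply, Finset.sum_eq_single j]
  · simp
  · intro k _ hk
    simp [hk]
  · simp

theorem isVTowerGen_single {o : Fin C.n} (h₁ : ∀ j, Uv ∣ C.dm o j) (h₂ : ∀ j, Uv ∣ C.dm j o)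
    (h₃ : ∀ i ≠ o, (∃ s m, C.dm s i = Vv ^ m ∧ ∀ j ≠ i, Uv ∣ C.dm s j) ∨
      ∃ t m, C.dm i t = Vv ^ m ∧ ∀ j ≠ i, Uv ∣ C.dm j t) :
    IsVTowerGen C (Finsupp.single o 1) := by
  refine ⟨mem_mulSub_iff_dvd.2 fun j => ?_, fun k hk => ?_, fun z hz => ⟨z o, ?_⟩⟩
  · rw [dmap_single_one]
    exact h₁ j
  · obtain ⟨u, hu, _, ⟨z, rfl⟩, h⟩ := Submodule.mem_sup.1 hk
    refine Vv_pow_not_dvd k ?_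
    have h0 := DFunLike.congr_fun h o
    rw [Finsupp.add_apply, dmap_apply, Finsupp.smul_apply, Finsupp.single_eq_same, smul_eq_mul,
      mul_one] at h0
    rw [← h0]
    exact dvd_add (mem_mulSub_iff_dvd.1 hu o) (Finset.dvd_sum fun i _ => (h₂ i).mul_left _)
  · change _ ∈ torU C
    have hsum := eq_sum_smul_single z
    rw [← Finset.add_sum_erase _ _ (Finset.mem_univ o), ← sub_eq_iff_eq_add'] at hsum
    rw [hsum]
    refine Submodule.sum_mem _ fun i hi => ?_
    rcases h₃ i (Finset.ne_of_mem_erase hi) with ⟨s, m, h, h'⟩ | ⟨t, m, h, h'⟩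
    · exact Submodule.smul_mem _ _ (single_mem_torU h h')
    · obtain ⟨c, hc⟩ := Uv_dvd_of_dmap_mem h h' hz
      rw [hc, mul_smul]
      exact uSub_le_torU ⟨_, rfl⟩

theorem dmap_single_one_eq_sum (i : Fin C.n) : dmap C (Finsupp.single i 1) =
    ∑ j, C.dm i j • (Finsupp.single j 1 : Msub C) := by
  simp [dmap_single]

/-! ### Standard complexes -/

theorem stdDm_of_neg {L : List ℤ} {i j : Fin (L.length + 1)} (hj : (j : ℕ) = i + 1)
    (h : L.getD i 0 < 0) : stdDm L i j = tv i ^ (L.getD i 0).natAbs := by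
  rw [stdDm, if_pos ⟨hj, h⟩, tv]

theorem stdDm_of_pos {L : List ℤ} {i j : Fin (L.length + 1)} (hi : (i : ℕ) = j + 1)
    (h : 0 < L.getD j 0) : stdDm L i j = tv j ^ (L.getD j 0).natAbs := by
  rw [stdDm, if_neg (by omega), if_pos ⟨hi, h⟩, tv]

theorem Uv_dvd_stdDm {L : List ℤ} {i j : Fin (L.length + 1)}
    (h₁ : (i : ℕ) % 2 = 1 → (j : ℕ) = i + 1 → 0 ≤ L.getD i 0)
    (h₂ : (j : ℕ) % 2 = 1 → (i : ℕ) = j + 1 → L.getD j 0 ≤ 0) : Uv ∣ stdDm L i j := by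
  unfold stdDm
  split_ifs with ha hb hc hd
  · exact dvd_pow_self _ (by omega)
  · exact absurd (h₁ (by omega) ha.1) (not_le.2 ha.2)
  · exact dvd_pow_self _ (by omega)
  · exact absurd (h₂ (by omega) hc.1) (not_le.2 hc.2)
  · exact dvd_zero _

/-- The generator `x_0` of a standard complex is a tower generator. -/
theorem isVTowerGen_std {L : List ℤ} (hL : IsStdSeq L) :
    IsVTowerGen (StdCx L) (Finsupp.single (0 : Fin (L.length + 1)) 1) := by
  refine isVTowerGen_single (C := StdCx L)
    (fun j => Uv_dvd_stdDm (L := L) (i := 0) (j := j) (by simp) (by simp))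
    (fun j => Uv_dvd_stdDm (L := L) (i := j) (j := 0) (by simp) (by simp)) fun i hi0 => ?_
  obtain ⟨k, hk, hkn, hik⟩ : ∃ k, k % 2 = 1 ∧ k < L.length ∧
      ((i : ℕ) = k ∨ (i : ℕ) = k + 1) := by
    have h1 := Nat.even_iff.1 hL.2
    have h2 : (i : ℕ) < L.length + 1 := i.2
    have h3 : (i : ℕ) ≠ 0 := fun h => hi0 (Fin.ext h)
    rcases Nat.mod_two_eq_zero_or_one i with h | h
    · exact ⟨i - 1, by omega, by omega, by omega⟩
    · exact ⟨i, h, by omega, by omega⟩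
  have hb : L.getD k 0 ≠ 0 := by
    rw [List.getD_eq_getElem _ _ hkn]
    exact hL.1 _ (List.getElem_mem _)
  have htv : tv k = Vv := by simp [tv, hk]
  let p : Fin (L.length + 1) := ⟨k, by omega⟩
  let q : Fin (L.length + 1) := ⟨k + 1, by omega⟩
  have hi : i = p ∨ i = q := hik.imp (fun h => Fin.ext h) fun h => Fin.ext h
  rcases lt_or_gt_of_ne hb with hb | hb
  · have hpq : stdDm L p q = Vv ^ (L.getD k 0).natAbs := htv ▸ stdDm_of_neg rfl hb
    rcases hi with rfl | rfl
    · refine Or.inr ⟨q, _, hpq, fun j hj => Uv_dvd_stdDm (L := L) ?_ ?_⟩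
      · intro _ h
        exact absurd (Fin.ext (Nat.succ_injective h.symm)) hj
      · intro h
        simp only [q] at h
        omega
    · refine Or.inl ⟨p, _, hpq, fun j hj => Uv_dvd_stdDm (L := L) ?_ ?_⟩
      · intro _ h
        exact absurd (Fin.ext h) hj
      · intro h h'
        simp only [p] at h'
        omega
  · have hpq : stdDm L q p = Vv ^ (L.getD k 0).natAbs := htv ▸ stdDm_of_pos rfl hb
    rcases hi with rfl | rfl
    · refine Or.inl ⟨q, _, hpq, fun j hj => Uv_dvd_stdDm (L := L) ?_ ?_⟩
      · intro h
        simp only [q] at h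
        omega
      · intro _ h
        exact absurd (Fin.ext (Nat.succ_injective h.symm)) hj
    · refine Or.inr ⟨p, _, hpq, fun j hj => Uv_dvd_stdDm (L := L) ?_ ?_⟩
      · intro h h'
        simp only [p] at h'
        omega
      · intro _ h
        exact absurd (Fin.ext h) hj

/-- The contribution of the `i`-th arrow to the differential of the `i`-th chain. -/
noncomputable def stdRight (b : ℕ → ℤ) (y : ℕ → Msub C) (i : ℕ) : Msub C :=
  if b i < 0 then tv i ^ (b i).natAbs • y (i + 1) else 0

/-- The contribution of the `(i - 1)`-st arrow to the differential of the `i`-th chain. -/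
noncomputable def stdLeft (b : ℕ → ℤ) (y : ℕ → Msub C) : ℕ → Msub C
  | 0 => 0
  | k + 1 => if 0 < b k then tv k ^ (b k).natAbs • y k else 0

theorem stdRight_mem (b : ℕ → ℤ) (y : ℕ → Msub C) (i : ℕ) :
    stdRight b y i ∈ mulSub C (tv i) := by
  unfold stdRight
  split_ifs with h
  · exact pow_smul_mem_mulSub _ (by omega) _
  · exact zero_mem _

theorem stdLeft_mem (b : ℕ → ℤ) (y : ℕ → Msub C) (i : ℕ) :
    stdLeft b y i ∈ mulSub C (tv (i + 1)) := by
  cases i with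
  | zero => exact zero_mem _
  | succ k =>
    rw [stdLeft, tv_add_two]
    split_ifs with h
    · exact pow_smul_mem_mulSub _ (by omega) _
    · exact zero_mem _

theorem sum_stdDm_smul (L : List ℤ) (y : ℕ → Msub C) (i : Fin (L.length + 1)) :
    ∑ j : Fin (L.length + 1), stdDm L i j • y j =
      stdRight (fun i => L.getD i 0) y i + stdLeft (fun i => L.getD i 0) y i := by
  have hlt : ∀ k, L.getD k 0 ≠ 0 → k < L.length := fun k hk => by
    by_contra h
    exact hk (List.getD_eq_default _ _ (not_lt.1 h))
  have h1 : ∑ j : Fin (L.length + 1), (if (j : ℕ) = i + 1 then stdRight (fun i => L.getD i 0) y i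
      else 0) = stdRight (fun i => L.getD i 0) y i := by
    by_cases hb : L.getD i 0 < 0
    · have := hlt i hb.ne
      rw [Finset.sum_eq_single ⟨i + 1, by omega⟩]
      · simp
      · intro j _ hj
        rw [if_neg fun h => hj (Fin.ext h)]
      · simp
    · have h0 : stdRight (fun i => L.getD i 0) y i = 0 := if_neg hb
      simp only [h0, ite_self, Finset.sum_const_zero]
  have h2 : ∑ j : Fin (L.length + 1), (if (i : ℕ) = j + 1 then stdLeft (fun i => L.getD i 0) y i
      else 0) = stdLeft (fun i => L.getD i 0) y i := by
    obtain ⟨i, hi⟩ := i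
    cases i with
    | zero => simp [stdLeft]
    | succ k =>
      rw [Finset.sum_eq_single ⟨k, by omega⟩]
      · simp
      · intro j _ hj
        rw [if_neg fun h => hj (Fin.ext (Nat.succ_injective h.symm))]
      · simp
  rw [← h1, ← h2, ← Finset.sum_add_distrib]
  refine Finset.sum_congr rfl fun j _ => ?_
  by_cases hj : (j : ℕ) = i + 1
  · rw [if_pos hj, if_neg (by omega), add_zero, stdRight, stdDm, if_neg (c := _ ∧ 0 < _) (by omega)]
    by_cases hb : L.getD i 0 < 0
    · rw [if_pos ⟨hj, hb⟩, if_pos hb, hj, tv]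
    · rw [if_neg fun h => hb h.2, if_neg hb, zero_smul]
  · rw [if_neg hj, zero_add, stdDm, if_neg fun h => hj h.1]
    by_cases hi : (i : ℕ) = j + 1
    · rw [if_pos hi, hi, stdLeft]
      by_cases hb : 0 < L.getD j 0
      · rw [if_pos ⟨rfl, hb⟩, if_pos hb, tv]
      · rw [if_neg fun h => hb h.2, if_neg hb, zero_smul]
    · rw [if_neg fun h => hi h.1, if_neg hi, zero_smul]

theorem dmap_std_single (L : List ℤ) (i : Fin (L.length + 1)) :
    dmap (StdCx L) (Finsupp.single i 1) =
      ∑ j : Fin (L.length + 1), stdDm L i j • (Finsupp.single j 1 : Msub (StdCx L)) :=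
  dmap_single_one_eq_sum (C := StdCx L) i

/-- A local map out of a standard complex gives a sequence of arrows. -/
theorem exists_isPath_of_localLE {L : List ℤ} (hL : IsStdSeq L) (h : LocalLE (StdCx L) C) :
    ∃ y, IsPath C (fun i => L.getD i 0) L.length y := by
  obtain ⟨f, hf⟩ := h
  let y : ℕ → Msub C := fun i =>
    if h : i < L.length + 1 then f (Finsupp.single (⟨i, h⟩ : Fin (L.length + 1)) 1) else 0
  have hy : ∀ j : Fin (L.length + 1), y j = f (Finsupp.single j 1) := fun j =>
    dif_pos j.2
  have hdy : ∀ i < L.length + 1, dmap C (y i) =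
      stdRight (fun i => L.getD i 0) y i + stdLeft (fun i => L.getD i 0) y i := by
    intro i hi
    rw [← sum_stdDm_smul L y ⟨i, hi⟩]
    refine (congrArg (dmap C) (hy ⟨i, hi⟩)).trans ?_
    rw [← hf.chain, dmap_std_single, map_sum]
    exact Finset.sum_congr rfl fun j _ => by rw [map_smul, hy]
  refine ⟨y, ?_, fun i hi => ⟨fun hb => ⟨?_, ?_⟩, fun hb => ⟨?_, ?_⟩⟩⟩
  · have := hf.towers _ (isVTowerGen_std hL)
    rwa [← hy 0] at this
  · rw [hdy i (by omega), stdRight, if_pos hb, add_sub_cancel_left]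
    exact stdLeft_mem _ _ _
  · rw [hdy (i + 1) (by omega), stdLeft, if_neg hb.not_gt, add_zero]
    exact stdRight_mem _ _ _
  · rw [hdy i (by omega), stdRight, if_neg hb.not_gt, zero_add]
    exact stdLeft_mem _ _ _
  · rw [hdy (i + 1) (by omega), stdLeft, if_pos hb, add_sub_cancel_right]
    exact stdRight_mem _ _ _

theorem IsPath.dmap_eq {b : ℕ → ℤ} {n : ℕ} {y : ℕ → Msub C} (h : IsPath C b n y)
    (hb : ∀ i < n, b i ≠ 0) (hn : y n = 0) (hbn : b n = 0) {i : ℕ} (hi : i ≤ n) :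
    dmap C (y i) = stdRight b y i + stdLeft b y i := by
  rw [← sub_eq_zero]
  refine eq_zero_of_mem_mulSub i ?_ ?_
  · have h1 : dmap C (y i) - stdLeft b y i ∈ mulSub C (tv i) := by
      cases i with
      | zero =>
        rw [stdLeft, sub_zero]
        exact h.tower.1
      | succ k =>
        rw [stdLeft]
        have hk := hb k hi
        split_ifs with hb
        · exact ((h.arr k hi).2 hb).2
        · rw [sub_zero]
          exact ((h.arr k hi).1 (by omega)).2
    convert sub_mem h1 (stdRight_mem b y i) using 1
    abel
  · have h1 : dmap C (y i) - stdRight b y i ∈ mulSub C (tv (i + 1)) := by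
      rw [stdRight]
      rcases hi.eq_or_lt with rfl | hi
      · simp [hn, hbn]
      · have hk := hb i hi
        split_ifs with hb
        · exact ((h.arr i hi).1 hb).1
        · rw [sub_zero]
          exact ((h.arr i hi).2 (by omega)).1
    convert sub_mem h1 (stdLeft_mem b y i) using 1
    abel

theorem map_mem_torU {C' : PreCx} {f : Msub C' →ₗ[RUV] Msub C}
    (hf : ∀ x, f (dmap C' x) = dmap C (f x)) {x : Msub C'} (hx : x ∈ torU C') :
    f x ∈ torU C := by
  obtain ⟨k, hk⟩ := hx
  obtain ⟨u, ⟨e, rfl⟩, _, ⟨z, rfl⟩, h⟩ := Submodule.mem_sup.1 hk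
  refine ⟨k, ?_⟩
  rw [← map_smul, ← h, map_add, hf]
  exact Submodule.add_mem_sup ⟨f e, by simp⟩ ⟨_, rfl⟩

theorem IsVTowerGen.map {C' : PreCx} {f : Msub C' →ₗ[RUV] Msub C}
    (hf : ∀ x, f (dmap C' x) = dmap C (f x)) {x₀ x : Msub C'} (hx₀ : IsVTowerGen C' x₀)
    (hfx₀ : IsVTowerGen C (f x₀)) (hx : IsVTowerGen C' x) : IsVTowerGen C (f x) := by
  obtain ⟨r, hr⟩ := (isVTowerGen_iff.1 hx).2.2 x₀ hx₀.1
  refine hfx₀.of_sub_smul_mem (r := r) ?_ ?_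
  · obtain ⟨e, he⟩ := hx.1
    exact ⟨f e, by rw [← hf, ← he]; simp⟩
  · rw [← map_smul, ← map_sub]
    exact map_mem_torU hf hr

/-- A sequence of arrows ending in zero gives a local map out of a standard complex. -/
theorem localLE_of_zero_mem_reach (hC : IsKnotLike C) {L : List ℤ} (hL : IsStdSeq L)
    (h : (0 : Msub C) ∈ reach C (fun i => L.getD i 0) L.length) : LocalLE (StdCx L) C := by
  obtain ⟨y₀, hy₀, hyn⟩ := exists_isPath h
  obtain ⟨s, hs⟩ := hy₀.exists_mcomp hC
  obtain ⟨y, hy, hn, hhom⟩ : ∃ y, IsPath C (fun i => L.getD i 0) L.length y ∧ y L.length = 0 ∧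
      ∀ i, ChainHomog C (y i) (chainDeg (fun i => L.getD i 0) s i).1
        (chainDeg (fun i => L.getD i 0) s i).2 :=
    ⟨_, hs, by simp only [hyn, mcomp_zero], fun i => chainHomog_mcomp _ _⟩
  have hb : ∀ i < L.length, L.getD i 0 ≠ 0 := fun i hi => by
    rw [List.getD_eq_getElem _ _ hi]
    exact hL.1 _ (List.getElem_mem _)
  let f : Msub (StdCx L) →ₗ[RUV] Msub C :=
    Finsupp.linearCombination RUV fun i : Fin (StdCx L).n => y i
  have hf1 : ∀ i : Fin (StdCx L).n, f (Finsupp.single i 1) = y i := fun i => by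
    simp [f, Finsupp.linearCombination_single]
  have hf : ∀ x, f (dmap (StdCx L) x) = dmap C (f x) := by
    refine LinearMap.congr_fun (f := f ∘ₗ dmap (StdCx L)) (g := dmap C ∘ₗ f) ?_
    refine Finsupp.lhom_ext' fun i => LinearMap.ext_ring ?_
    change f (dmap (StdCx L) (Finsupp.single i 1)) = dmap C (f (Finsupp.single i 1))
    rw [hf1, hy.dmap_eq hb hn (List.getD_eq_default _ _ le_rfl) (Nat.lt_succ_iff.1 i.2),
      dmap_single_one_eq_sum, map_sum]
    refine (Finset.sum_congr rfl fun j _ => ?_).trans (sum_stdDm_smul L y i)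
    rw [map_smul, hf1]
    rfl
  refine ⟨f, hf, ⟨s + (grRel L L.length).2, fun i j => ?_⟩, fun x hx => ?_⟩
  · rw [hf1]
    convert hhom i j using 2
    · simp [StdCx, stdGr, grRel, chainDeg]
    · simp [StdCx, stdGr, grRel, chainDeg]
      ring
  · exact IsVTowerGen.map hf (isVTowerGen_std hL) ((hf1 _).symm ▸ hy.tower) hx

end

theorem qval_pos {b : ℤ} (hb : 0 < b) : 0 < qval b := by
  rw [qval, if_neg hb.ne']
  exact one_div_pos.2 (by exact_mod_cast hb)

theorem qval_neg {b : ℤ} (hb : b < 0) : qval b < 0 := by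
  rw [qval, if_neg hb.ne]
  exact one_div_neg.2 (by exact_mod_cast hb)

/-- A nonzero supremum with respect to `≤^!` is attained. -/
theorem IsBangLUB.mem {S : Set ℤ} {m : ℤ} (h : IsBangLUB S m) (hm : m ≠ 0) (hS : ∀ b ∈ S, b ≠ 0)
    (hne : S.Nonempty) : m ∈ S := by
  by_contra hmS
  have hlt : ∀ b ∈ S, (b < 0 ∧ 0 < m) ∨ (0 < m ∧ m < b) ∨ (m < b ∧ b < 0) := fun b hb =>
    qval_lt_cases hm (hS b hb) (lt_of_le_of_ne (h.1 b hb) fun heq =>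
      hmS (qval_injective_of_ne_zero (hS b hb) hm heq ▸ hb))
  have hub : IsBangUB S (m + 1) := by
    intro b hb
    rcases eq_or_ne b (m + 1) with rfl | hbm
    · exact le_rfl
    rcases hlt b hb with ⟨h1, h2⟩ | ⟨h1, h2⟩ | ⟨h1, h2⟩
    · exact ((qval_neg h1).trans (qval_pos (by omega))).le
    · exact (qval_lt_of_pos (by omega) (by omega)).le
    · exact (qval_lt_of_neg h2 (by omega)).le
  refine absurd (h.2 _ hub) (not_le.2 ?_)
  obtain ⟨b, hb⟩ := hne
  rcases lt_or_gt_of_ne hm with h0 | h0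
  · have := hlt b hb
    exact qval_lt_of_neg (by omega) (by omega)
  · exact qval_lt_of_pos h0 (by omega)

section
variable {C : PreCx}

theorem mem_candSet_of_arr (hC : IsKnotLike C) {a : ℕ → ℤ} (ha : ∀ i, a i ≠ 0) {k : ℕ} {b : ℤ}
    (hb : b ≠ 0) {x y : Msub C} (hx : x ∈ reach C a k) (h : Arr C k b x y) :
    b ∈ candSet C ((List.range k).map a) := by
  have hy : y ∈ reach C (Function.update a k b) (k + 1) := by
    refine ⟨x, ?_, by rwa [Function.update_self]⟩
    rwa [reach_congr (c := a) fun i hi => Function.update_of_ne hi.ne _ _]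
  obtain ⟨M, hM⟩ := exists_zero_mem_reach hC (fun i _ => by
    rcases eq_or_ne i k with rfl | hi
    · rwa [Function.update_self]
    · rw [Function.update_of_ne hi]
      exact ha i) ⟨y, hy⟩
  obtain ⟨j, hj, hkj⟩ : ∃ j ≥ M, Even (k + 1 + j) := by
    rcases Nat.even_or_odd (k + 1 + M) with h | h
    · exact ⟨M, le_rfl, h⟩
    · exact ⟨M + 1, by omega, h.add_one⟩
  have hlen : ((List.range k).map a ++ b :: List.replicate j (-1)).length = k + 1 + j := by
    simp
    omega
  have hL : IsStdSeq ((List.range k).map a ++ b :: List.replicate j (-1)) := by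
    refine ⟨fun c hc => ?_, hlen ▸ hkj⟩
    simp only [List.mem_append, List.mem_map, List.mem_cons, List.mem_replicate] at hc
    rcases hc with ⟨i, -, rfl⟩ | rfl | ⟨-, rfl⟩
    · exact ha i
    · exact hb
    · norm_num
  refine ⟨hb, _, hL, localLE_of_zero_mem_reach hC hL ?_⟩
  rw [hlen]
  convert hM j hj using 1
  refine reach_congr fun i hi => ?_
  rcases lt_trichotomy i k with hik | rfl | hik
  · rw [if_pos (by omega), Function.update_of_ne hik.ne, List.getD_append _ _ _ _ (by simpa)]
    simp [hik]
  · rw [if_pos (by omega), Function.update_self, List.getD_append_right _ _ _ _ (by simp)]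
    simp
  · rw [if_neg (by omega), List.getD_append_right _ _ _ _ (by simp; omega)]
    obtain ⟨l, rfl⟩ := Nat.exists_eq_add_of_lt hik
    have hl : l < j := by omega
    simp [show k + l + 1 - k = l + 1 by omega, hl]

theorem reach_nonempty_of_mem_candSet {a : ℕ → ℤ} {k : ℕ}
    (h : a k ∈ candSet C ((List.range k).map a)) : (reach C a (k + 1)).Nonempty := by
  obtain ⟨-, rest, hL, hle⟩ := h
  obtain ⟨y, hy⟩ := exists_isPath_of_localLE hL hle
  refine ⟨y (k + 1), ?_⟩
  have h1 := hy.mem_reach (i := k + 1) (by simp)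
  rwa [reach_congr (c := a)] at h1
  intro i hi
  rcases Nat.lt_succ_iff_lt_or_eq.1 hi with hik | rfl
  · rw [List.getD_append _ _ _ _ (by simpa)]
    simp [hik]
  · rw [List.getD_append_right _ _ _ _ (by simp)]
    simp

theorem exists_eq_smul_add_of_augm {x : Msub C} (h : ∀ j, augm (x j) = 0) :
    ∃ e g : Msub C, x = Uv • e + Vv • g := by
  choose s t hst using fun j => exists_eq_of_augm (x j)
  refine ⟨Finsupp.equivFunOnFinite.symm s, Finsupp.equivFunOnFinite.symm t, ?_⟩
  ext j
  simpa using (hst j).1 (h j)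

/-- Parameters cannot be maximal at every stage. -/
theorem exists_not_maximal (hC : IsKnotLike C) {a : ℕ → ℤ} (ha : ∀ i, a i ≠ 0)
    (hne : ∀ k, (reach C a k).Nonempty) :
    ¬ ∀ i b, b ≠ 0 → ∀ x ∈ reach C a i, ∀ y, Arr C i b x y → qval b ≤ qval (a i) := by
  intro hmax
  choose w hw using fun k => hne (2 * k)
  obtain ⟨k, l, hkl, heq⟩ := Finite.exists_ne_map_eq_of_infinite fun k j => augm (w k j)
  wlog hlt : k < l generalizing k l
  · exact this l k hkl.symm heq.symm (lt_of_le_of_ne (not_lt.1 hlt) hkl.symm)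
  obtain ⟨e, g, heg⟩ := exists_eq_smul_add_of_augm (x := w k + w l) fun j => by
    have h2 : ∀ c : ZMod 2, c + c = 0 := by decide
    rw [Finsupp.add_apply, map_add, congrFun heq j, h2]
  have hbad : ∀ i, w k + w l ∉ reach C a (2 * i) := fun i hi => by
    refine reach_not_eq hC ha hmax hi e g 0 ?_
    rw [heg, show tv (2 * i) = Uv by simp [tv],
      show tv (2 * i + 1) = Vv by simp [tv, Nat.add_mod], map_zero, add_zero]
  have hl := hw l
  rw [show 2 * l = 2 * k + 2 * (l - k) by omega] at hl
  rcases reach_merge (by simp) (by omega) (fun i _ => ha i) (hw k) hl with h | h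
  · exact hbad k h
  · rw [← Nat.mul_add] at h
    exact hbad _ h

end

/-- For every knot-like complex `C`, the numerical invariants satisfy
`a_i(C) = 0` for all sufficiently large `i`. -/
theorem invariants_eventually_zero (C : PreCx) (hC : IsKnotLike C)
    (a : ℕ → ℤ) (ha : InvSeq C a) :
    ∃ N : ℕ, ∀ i ≥ N, a i = 0 := by
  by_contra hcon
  have ha0 : ∀ i, a i ≠ 0 := fun i hi =>
    hcon ⟨i, fun j hj => hj.eq_or_lt.elim (fun h => h ▸ hi) fun h => (ha j).1 ⟨i, h, hi⟩⟩
  have hlub : ∀ k, IsBangLUB (candSet C ((List.range k).map a)) (a k) := fun k =>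
    (ha k).2 fun i _ => ha0 i
  have hne : ∀ k, (reach C a k).Nonempty := by
    intro k
    induction k with
    | zero => exact hC.vTowerExists
    | succ k ih =>
      obtain ⟨x, hx⟩ := ih
      obtain ⟨y, hy⟩ := exists_arr_neg_one hC (fun i _ => ha0 i) hx
      exact reach_nonempty_of_mem_candSet ((hlub k).mem (ha0 k) (fun b hb => hb.1)
        ⟨-1, mem_candSet_of_arr hC ha0 (by norm_num) hx hy⟩)
  exact exists_not_maximal hC ha0 hne fun i b hb x hx y h =>
    (hlub i).1 b (mem_candSet_of_arr hC ha0 hb hx h)
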